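/- arXiv:2411.12927 — 3 statements merged into one kernel-verified Lean document; each statement's English description precedes it below -/
import Mathlib

section
/- Let X be a second countable Stone space, x ∈ X, and Ω a stable clopen neighborhood of x, with a fixed decomposition Ω \ {x} = ⋃_{k≥1} Y_k as guaranteed by stability. Suppose W ⊆ Homeo(X) is symmetric, countably many left translates of W cover Homeo(X), and G(Ω) is contained in the closure of W·W. Then every homeomorphism h of X with h(x) = x that is supported on a brick of the decomposition belongs to W²⁴. -/
open Pointwise Topology

/-- The group of self-homeomorphisms of a space, with `(f * g) x = f (g x)`. -/
instance homeoGroup (X : Type*) [TopologicalSpace X] : Group (X ≃ₜ X) where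
  mul f g := g.trans f
  one := Homeomorph.refl X
  inv := Homeomorph.symm
  mul_assoc _ _ _ := Homeomorph.ext fun _ => rfl
  one_mul _ := Homeomorph.ext fun _ => rfl
  mul_one _ := Homeomorph.ext fun _ => rfl
  inv_mul_cancel f := Homeomorph.ext fun x => f.symm_apply_apply x

/-- The compact-open topology on the homeomorphism group. -/
instance homeoTop (X : Type*) [TopologicalSpace X] : TopologicalSpace (X ≃ₜ X) :=
  TopologicalSpace.induced (fun f : X ≃ₜ X => (f : C(X, X))) ContinuousMap.compactOpen

/-- `U` is a stable clopen neighborhood of `x`: for every clopen neighborhood `U' ⊆ U` of `x`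
there is a homeomorphism `U ≃ₜ U'` fixing `x`. -/
def IsStableNbhd {X : Type*} [TopologicalSpace X] (x : X) (U : Set X) : Prop :=
  IsClopen U ∧ U ∈ nhds x ∧
    ∀ U' : Set X, U' ⊆ U → IsClopen U' → U' ∈ nhds x →
      ∃ Φ : (U : Set X) ≃ₜ (U' : Set X), ∀ hx : x ∈ U, ((Φ ⟨x, hx⟩ : U') : X) = x

/-- `Y k ↘ x`: every sequence of points chosen from the sets `Y k` converges to `x`. -/
def DescendsTo {X : Type*} [TopologicalSpace X] (Y : ℕ → Set X) (x : X) : Prop :=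
  ∀ u : ℕ → X, (∀ k, u k ∈ Y k) → Filter.Tendsto u Filter.atTop (nhds x)

/-- A decomposition `Ω \ {x} = ⋃ Y k` of a stable neighborhood as guaranteed by stability
(here `Y k` plays the role of `Y_{k+1}` of the paper): the pieces are nonempty, pairwise
disjoint and clopen, they descend to `x`, each `Y (k+1)` contains a clopen copy of `Y k`,
and for every infinite increasing sequence of indices `κ` the space `Ω \ {x}` is
homeomorphic to `⋃ n, Y (κ n)`. -/
structure IsStableDecomp {X : Type*} [TopologicalSpace X] (x : X) (Ω : Set X)
    (Y : ℕ → Set X) : Prop where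
  nonempty : ∀ k, (Y k).Nonempty
  clopen : ∀ k, IsClopen (Y k)
  disj : ∀ k l, k ≠ l → Disjoint (Y k) (Y l)
  union : Ω \ {x} = ⋃ k, Y k
  descends : DescendsTo Y x
  contains : ∀ k, ∃ Z : Set X, Z ⊆ Y (k + 1) ∧ IsClopen Z ∧
    Nonempty ((Y k : Set X) ≃ₜ (Z : Set X))
  subseq : ∀ κ : ℕ → ℕ, StrictMono κ →
    Nonempty (((Ω \ {x} : Set X)) ≃ₜ ((⋃ n, Y (κ n) : Set X)))

/-- A brick relative to the decomposition `Y`: a union `⋃ k ∈ S, Y k` with `S` infinite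
and co-infinite. -/
def IsBrick {X : Type*} [TopologicalSpace X] (Y : ℕ → Set X) (B : Set X) : Prop :=
  ∃ S : Set ℕ, S.Infinite ∧ Sᶜ.Infinite ∧ B = ⋃ k ∈ S, Y k

/-- `B` is a subbrick of the brick `A`, relative to the decomposition `Y`. -/
def IsSubbrick {X : Type*} [TopologicalSpace X] (Y : ℕ → Set X) (A B : Set X) : Prop :=
  ∃ S S' : Set ℕ, S.Infinite ∧ Sᶜ.Infinite ∧ S' ⊆ S ∧ S'.Infinite ∧ (S \ S').Infinite ∧
    A = ⋃ k ∈ S, Y k ∧ B = ⋃ k ∈ S', Y k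

/-- `f` is supported on `A`: it is the identity outside `A`. -/
def SuppOn {X : Type*} [TopologicalSpace X] (f : X ≃ₜ X) (A : Set X) : Prop :=
  ∀ y : X, y ∉ A → f y = y

/-- The set of homeomorphisms of `X` supported on `A`. -/
def suppIn {X : Type*} [TopologicalSpace X] (A : Set X) : Set (X ≃ₜ X) :=
  {f | SuppOn f A}

/-- The union of the first `n` pieces of the decomposition (`Y[n]` in the paper). -/
def blockUnion {X : Type*} [TopologicalSpace X] (Y : ℕ → Set X) (n : ℕ) : Set X :=
  ⋃ i ∈ Finset.range n, Y i


/-! ### Embeddings with clopen range and extensions of homeomorphisms -/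

theorem isOpenMap_prodMk_nat {M : Type*} [TopologicalSpace M] (n : ℕ) :
    IsOpenMap (Prod.mk n : M → ℕ × M) := by
  intro U hU
  rw [← Set.singleton_prod]
  exact (isOpen_discrete _).prod hU

/-- Embeddings with clopen range. -/
structure IsClopenEmb {M N : Type*} [TopologicalSpace M] [TopologicalSpace N] (e : M → N) :
    Prop where
  isOpenEmbedding : IsOpenEmbedding e
  isClosed_range : IsClosed (Set.range e)

namespace IsClopenEmb

variable {M N P : Type*} [TopologicalSpace M] [TopologicalSpace N] [TopologicalSpace P]

theorem isClosedEmbedding {e : M → N} (he : IsClopenEmb e) : IsClosedEmbedding e :=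
  ⟨he.isOpenEmbedding.isEmbedding, he.isClosed_range⟩

theorem injective {e : M → N} (he : IsClopenEmb e) : Function.Injective e :=
  he.isOpenEmbedding.injective

theorem of_open_closed {e : M → N} (ho : IsOpenEmbedding e) (hc : IsClosedEmbedding e) :
    IsClopenEmb e :=
  ⟨ho, hc.isClosed_range⟩

theorem comp {e : M → N} {d : N → P} (hd : IsClopenEmb d) (he : IsClopenEmb e) :
    IsClopenEmb (d ∘ e) :=
  of_open_closed (hd.isOpenEmbedding.comp he.isOpenEmbedding)
    (hd.isClosedEmbedding.comp he.isClosedEmbedding)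

theorem homeo (f : M ≃ₜ N) : IsClopenEmb f :=
  of_open_closed f.isOpenEmbedding f.isClosedEmbedding

theorem sumElim {e : M → P} {d : N → P} (he : IsClopenEmb e) (hd : IsClopenEmb d)
    (h : ∀ m n, e m ≠ d n) : IsClopenEmb (Sum.elim e d) := by
  have hi : Function.Injective (Sum.elim e d) := he.injective.sumElim hd.injective h
  exact of_open_closed (he.isOpenEmbedding.sumElim hd.isOpenEmbedding hi)
    (he.isClosedEmbedding.sumElim hd.isClosedEmbedding hi)

/-- Reindexing the discrete factor along an injection. -/
theorem reindex {j : ℕ → ℕ} (hj : Function.Injective j) :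
    IsClopenEmb (fun p : ℕ × M => (j p.1, p.2)) := by
  refine ⟨.of_continuous_injective_isOpenMap (by fun_prop) ?_ ?_, ?_⟩
  · rintro ⟨a, m⟩ ⟨b, n⟩ h
    simp only [Prod.mk.injEq] at h
    rw [hj h.1, h.2]
  · exact IsOpenMap.prodMap (fun _ _ => isOpen_discrete _) IsOpenMap.id
  · have : Set.range (fun p : ℕ × M => (j p.1, p.2)) = Prod.fst ⁻¹' (Set.range j) := by
      ext ⟨a, m⟩
      simp
    rw [this]
    exact (isClosed_discrete _).preimage continuous_fst

/-- A sequence of embeddings with clopen range, taken fibrewise. -/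
theorem fibrewise {k : ℕ → M → N} (hk : ∀ n, IsClopenEmb (k n)) :
    IsClopenEmb (fun p : ℕ × M => (p.1, k p.1 p.2)) := by
  refine ⟨.of_continuous_injective_isOpenMap ?_ ?_ ?_, ?_⟩
  · rw [continuous_prod_of_discrete_left]
    intro n
    exact continuous_const.prodMk (hk n).isOpenEmbedding.continuous
  · rintro ⟨a, m⟩ ⟨b, n⟩ h
    simp only [Prod.mk.injEq] at h
    obtain ⟨rfl, h⟩ := h
    rw [(hk a).injective h]
  · rw [isOpenMap_prod_of_discrete_left]
    intro n
    exact (isOpenMap_prodMk_nat n).comp (hk n).isOpenEmbedding.isOpenMap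
  · rw [← isOpen_compl_iff]
    have : (Set.range (fun p : ℕ × M => (p.1, k p.1 p.2)))ᶜ =
        ⋃ n, Prod.mk n '' (Set.range (k n))ᶜ := by
      ext ⟨a, m⟩
      simp
    rw [this]
    exact isOpen_iUnion fun n =>
      isOpenMap_prodMk_nat n _ (hk n).isClosed_range.isOpen_compl

theorem slice (n : ℕ) : IsClopenEmb (fun m : M => (n, m)) := by
  refine ⟨.of_continuous_injective_isOpenMap (by fun_prop) ?_ (isOpenMap_prodMk_nat n), ?_⟩
  · intro a b h
    simpa using h
  · have : Set.range (fun m : M => (n, m)) = Prod.fst ⁻¹' {n} := by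
      ext ⟨a, m⟩
      simp [eq_comm]
    rw [this]
    exact (isClosed_discrete _).preimage continuous_fst

end IsClopenEmb

/-- Open embeddings with pairwise disjoint ranges covering the space assemble to a
homeomorphism. -/
theorem exists_prod_homeo {M N : Type*} [TopologicalSpace M] [TopologicalSpace N]
    (e : ℕ → M → N) (he : ∀ n, IsOpenEmbedding (e n))
    (hd : ∀ i j, ∀ m m', e i m = e j m' → i = j) (hs : ∀ y, ∃ i m, e i m = y) :
    ∃ c : ℕ × M ≃ₜ N, ∀ n m, c (n, m) = e n m := by
  have hb : Function.Bijective (fun p : ℕ × M => e p.1 p.2) := by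
    constructor
    · rintro ⟨a, m⟩ ⟨b, n⟩ h
      obtain rfl := hd _ _ _ _ h
      exact Prod.ext rfl ((he a).injective h)
    · intro y
      obtain ⟨i, m, rfl⟩ := hs y
      exact ⟨(i, m), rfl⟩
  refine ⟨(Equiv.ofBijective _ hb).toHomeomorphOfContinuousOpen ?_ ?_, fun n m => rfl⟩
  · exact continuous_prod_of_discrete_left.2 fun n => (he n).continuous
  · exact isOpenMap_prod_of_discrete_left.2 fun n => (he n).isOpenMap

theorem continuousAt_extend_of_mem_range {X M : Type*} [TopologicalSpace X] [TopologicalSpace M]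
    {e : M → X} (he : IsOpenEmbedding e) (f : M ≃ₜ M) (m : M) :
    ContinuousAt (Function.extend e (e ∘ f) id) (e m) := by
  rw [← he.continuousAt_iff]
  have : Function.extend e (e ∘ f) id ∘ e = e ∘ f :=
    funext fun m => he.injective.extend_apply _ _ _
  rw [this]
  exact (he.continuous.comp f.continuous).continuousAt

theorem continuousAt_extend_of_notMem_closed {X M : Type*} [TopologicalSpace X]
    [TopologicalSpace M] {e : M → X} (f : M ≃ₜ M) {C : Set X} (hC : IsClosed C)
    (hr : Set.range e ⊆ C) {y : X} (hy : y ∉ C) :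
    ContinuousAt (Function.extend e (e ∘ f) id) y := by
  have : Function.extend e (e ∘ f) id =ᶠ[𝓝 y] id := by
    filter_upwards [hC.isOpen_compl.mem_nhds hy] with z hz
    exact Function.extend_apply' _ _ _ fun ⟨a, ha⟩ => hz (hr ⟨a, ha⟩)
  exact continuousAt_id.congr this.symm

theorem extend_leftInverse {X M : Type*} [TopologicalSpace M] {e : M → X}
    (he : Function.Injective e) (f : M ≃ₜ M) :
    Function.LeftInverse (Function.extend e (e ∘ f.symm) id) (Function.extend e (e ∘ f) id) := by
  intro y
  by_cases h : ∃ m, e m = y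
  · obtain ⟨m, rfl⟩ := h
    simp [he.extend_apply]
  · rw [Function.extend_apply' _ _ y h, id, Function.extend_apply' _ _ y h, id]

/-- Extension by the identity, when the range closes up by adding at most one point. -/
theorem exists_extend {X M : Type*} [TopologicalSpace X] [CompactSpace X] [T2Space X]
    [TopologicalSpace M] (x : X) {e : M → X} (he : IsOpenEmbedding e)
    (hc : IsClosed (insert x (Set.range e))) (f : M ≃ₜ M) :
    ∃ F : X ≃ₜ X, (∀ m, F (e m) = e (f m)) ∧ ∀ y, y ∉ Set.range e → F y = y := by
  have key : ∀ f : M ≃ₜ M, Continuous (Function.extend e (e ∘ f) id) := by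
    intro f
    rw [continuous_iff_continuousAt]
    intro y
    by_cases hy : y ∈ Set.range e
    · obtain ⟨m, rfl⟩ := hy
      exact continuousAt_extend_of_mem_range he f m
    by_cases hyx : y = x
    swap
    · exact continuousAt_extend_of_notMem_closed f hc (Set.subset_insert _ _)
        (by simp only [Set.mem_insert_iff, not_or]; exact ⟨hyx, hy⟩)
    subst hyx
    have hfix : Function.extend e (e ∘ f) id y = y := Function.extend_apply' _ _ _ hy
    rw [ContinuousAt, hfix, (nhds_basis_opens y).tendsto_right_iff]
    rintro U ⟨hyU, hU⟩
    have hK : IsCompact (e ⁻¹' Uᶜ) := by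
      rw [he.isInducing.isCompact_iff, Set.image_preimage_eq_inter_range]
      have : Uᶜ ∩ Set.range e = Uᶜ ∩ insert y (Set.range e) := by
        ext z
        simp only [Set.mem_inter_iff, Set.mem_compl_iff, Set.mem_insert_iff]
        constructor
        · exact fun h => ⟨h.1, Or.inr h.2⟩
        · rintro ⟨h, rfl | h'⟩
          · exact absurd hyU h
          · exact ⟨h, h'⟩
      rw [this]
      exact (hU.isClosed_compl.inter hc).isCompact
    have hK' : IsClosed (e '' (f ⁻¹' (e ⁻¹' Uᶜ))) :=
      ((f.isCompact_preimage.2 hK).image he.continuous).isClosed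
    have hyK : y ∉ e '' (f ⁻¹' (e ⁻¹' Uᶜ)) := fun ⟨m, _, hm⟩ => hy ⟨m, hm⟩
    filter_upwards [hK'.isOpen_compl.mem_nhds hyK, hU.mem_nhds hyU] with z hz hzU
    by_cases hzr : ∃ m, e m = z
    · obtain ⟨m, rfl⟩ := hzr
      rw [he.injective.extend_apply]
      by_contra hcon
      exact hz ⟨m, hcon, rfl⟩
    · rwa [Function.extend_apply' _ _ _ hzr]
  refine ⟨⟨⟨_, _, extend_leftInverse he.injective f, ?_⟩, key f, key f.symm⟩, ?_, ?_⟩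
  · exact extend_leftInverse he.injective f.symm
  · exact fun m => he.injective.extend_apply _ _ _
  · exact fun y hy => Function.extend_apply' _ _ _ hy

theorem IsClopenEmb.exists_extend {X M : Type*} [TopologicalSpace X] [TopologicalSpace M]
    {e : M → X} (he : IsClopenEmb e) (f : M ≃ₜ M) :
    ∃ F : X ≃ₜ X, (∀ m, F (e m) = e (f m)) ∧ ∀ y, y ∉ Set.range e → F y = y := by
  have key : ∀ f : M ≃ₜ M, Continuous (Function.extend e (e ∘ f) id) := by
    intro f
    rw [continuous_iff_continuousAt]
    intro y
    by_cases hy : y ∈ Set.range e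
    · obtain ⟨m, rfl⟩ := hy
      exact continuousAt_extend_of_mem_range he.isOpenEmbedding f m
    · exact continuousAt_extend_of_notMem_closed f he.isClosed_range subset_rfl hy
  refine ⟨⟨⟨_, _, extend_leftInverse he.injective f, ?_⟩, key f, key f.symm⟩, ?_, ?_⟩
  · exact extend_leftInverse he.injective f.symm
  · exact fun m => he.injective.extend_apply _ _ _
  · exact fun y hy => Function.extend_apply' _ _ _ hy

/-- A homeomorphism preserving the range of an embedding restricts to its source. -/
theorem exists_restrict {X M : Type*} [TopologicalSpace X] [TopologicalSpace M] {e : M → X}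
    (he : IsEmbedding e) (g : X ≃ₜ X) (hg : ∀ y, y ∈ Set.range e ↔ g y ∈ Set.range e) :
    ∃ f : M ≃ₜ M, ∀ m, e (f m) = g (e m) := by
  have hs : Set.range e = g ⁻¹' Set.range e := Set.ext hg
  refine ⟨(he.toHomeomorph.trans (g.sets hs)).trans he.toHomeomorph.symm, fun m => ?_⟩
  have h := he.toHomeomorph.apply_symm_apply ((g.sets hs) (he.toHomeomorph m))
  exact congrArg Subtype.val h

/-- A continuous involution as a homeomorphism. -/
def Function.Involutive.toHomeo {M : Type*} [TopologicalSpace M] {f : M → M}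
    (hi : Function.Involutive f) (hc : Continuous f) : M ≃ₜ M where
  toEquiv := hi.toPerm
  continuous_toFun := hc
  continuous_invFun := hc

theorem Function.Involutive.toHomeo_apply {M : Type*} [TopologicalSpace M] {f : M → M}
    (hi : Function.Involutive f) (hc : Continuous f) (m : M) : hi.toHomeo hc m = f m :=
  rfl

theorem continuous_dite_of_isClopen {M N : Type*} [TopologicalSpace M] [TopologicalSpace N]
    {p : M → Prop} [DecidablePred p] (hp : IsClopen {z | p z}) {f : ∀ z, p z → N} {g : M → N}
    (hf : Continuous fun z : {z // p z} => f z z.2) (hg : Continuous g) :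
    Continuous fun z => if h : p z then f z h else g z := by
  rw [continuous_iff_continuousAt]
  intro z
  by_cases h : p z
  · have ho : IsOpenEmbedding (Subtype.val : {z // p z} → M) :=
      hp.isOpen.isOpenEmbedding_subtypeVal
    have key := ho.continuousAt_iff (g := fun z => if h : p z then f z h else g z) (x := ⟨z, h⟩)
    rw [← key]
    have : (fun z => if h : p z then f z h else g z) ∘ (Subtype.val : {z // p z} → M) =
        fun z : {z // p z} => f z z.2 :=
      funext fun y => dif_pos y.2
    rw [this]
    exact hf.continuousAt
  · have : (fun z => if h : p z then f z h else g z) =ᶠ[𝓝 z] g := by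
      filter_upwards [hp.compl.isOpen.mem_nhds h] with y hy
      exact dif_neg hy
    exact hg.continuousAt.congr this.symm

/-- Exchange the two copies of the fibres indexed by `J`. -/
theorem exists_swap_fibres (M : Type*) [TopologicalSpace M] (J : Set ℕ) :
    ∃ F : (ℕ × M) ⊕ (ℕ × M) ≃ₜ (ℕ × M) ⊕ (ℕ × M),
      (∀ j m, j ∈ J → F (.inl (j, m)) = .inr (j, m) ∧ F (.inr (j, m)) = .inl (j, m)) ∧
      (∀ j m, j ∉ J → F (.inl (j, m)) = .inl (j, m) ∧ F (.inr (j, m)) = .inr (j, m)) := by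
  classical
  let f : (ℕ × M) ⊕ (ℕ × M) → (ℕ × M) ⊕ (ℕ × M) :=
    Sum.elim (fun p => if p.1 ∈ J then .inr p else .inl p)
      (fun p => if p.1 ∈ J then .inl p else .inr p)
  have hf : Function.Involutive f := by
    rintro (⟨j, m⟩ | ⟨j, m⟩) <;> by_cases h : j ∈ J <;> simp [f, h]
  have hc : Continuous f := by
    refine Continuous.sumElim ?_ ?_ <;> rw [continuous_prod_of_discrete_left] <;> intro j <;>
      by_cases h : j ∈ J <;> simp only [h, if_true, if_false] <;> fun_prop
  refine ⟨hf.toHomeo hc, ?_, ?_⟩ <;> intro j m h <;>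
    simp [Function.Involutive.toHomeo_apply, f, h]

/-! ### Block spaces -/

/-- The structure carried by `Ω \ {x}` : a continuous index function with compact sublevel sets,
such that the part with index in any infinite set is a copy of the whole space. -/
structure IsBlockSpace {Z : Type*} [TopologicalSpace Z] (μ : Z → ℕ) : Prop where
  continuous : Continuous μ
  compact : ∀ n, IsCompact {z | μ z ≤ n}
  exists_emb : ∀ κ : ℕ → ℕ, StrictMono κ →
    ∃ e : Z → Z, IsOpenEmbedding e ∧ Set.range e = μ ⁻¹' Set.range κ

/-- Only finitely many slices of a clopen embedding meet a compact set. -/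
theorem IsClopenEmb.exists_slice_disjoint {M N : Type*} [TopologicalSpace M] [TopologicalSpace N]
    {e : ℕ × M → N} (he : IsClopenEmb e) {K : Set N} (hK : IsCompact K) :
    ∃ j, ∀ m, e (j, m) ∉ K := by
  have h1 : IsCompact (Prod.fst '' (e ⁻¹' K)) :=
    (he.isClosedEmbedding.isCompact_preimage hK).image continuous_fst
  obtain ⟨j, hj⟩ := h1.finite_of_discrete.exists_notMem
  exact ⟨j, fun m hm => hj ⟨(j, m), hm, rfl⟩⟩

namespace IsBlockSpace

variable {Z : Type*} [TopologicalSpace Z] {μ : Z → ℕ}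

theorem isClopen_preimage (hμ : IsBlockSpace μ) (S : Set ℕ) : IsClopen (μ ⁻¹' S) :=
  (isClopen_discrete S).preimage hμ.continuous

theorem exists_clopenEmb (hμ : IsBlockSpace μ) {S : Set ℕ} (hS : S.Infinite) :
    ∃ e : Z → Z, IsClopenEmb e ∧ Set.range e = μ ⁻¹' S := by
  obtain ⟨e, he, hr⟩ := hμ.exists_emb (Nat.nth (· ∈ S)) (Nat.nth_strictMono hS)
  rw [show Set.range (Nat.nth (· ∈ S)) = S from Nat.range_nth_of_infinite hS] at hr
  refine ⟨e, ⟨he, ?_⟩, hr⟩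
  rw [hr]
  exact (hμ.isClopen_preimage _).isClosed

theorem exists_bound (hμ : IsBlockSpace μ) {N : Type*} [TopologicalSpace N] {a : Z → N}
    (ha : IsClopenEmb a) {K : Set N} (hK : IsCompact K) : ∃ n, ∀ z, a z ∈ K → μ z < n := by
  have h1 : IsCompact (μ '' (a ⁻¹' K)) :=
    (ha.isClosedEmbedding.isCompact_preimage hK).image hμ.continuous
  obtain ⟨n, hn⟩ := h1.finite_of_discrete.bddAbove
  exact ⟨n + 1, fun z hz => Nat.lt_succ_of_le (hn ⟨z, hz, rfl⟩)⟩

theorem compact_eq (hμ : IsBlockSpace μ) (n : ℕ) : IsCompact {z | μ z = n} :=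
  (hμ.compact n).of_isClosed_subset (hμ.isClopen_preimage {n}).isClosed fun _ h => le_of_eq h

theorem exists_prod_self (hμ : IsBlockSpace μ) : Nonempty (ℕ × Z ≃ₜ Z) := by
  have hinf : ∀ j, (Set.range (Nat.pair j)).Infinite := fun j =>
    Set.infinite_range_of_injective fun a b h => (Nat.pair_eq_pair.1 h).2
  choose e he hr using fun j => hμ.exists_clopenEmb (hinf j)
  have hm : ∀ j z, ∃ n, Nat.pair j n = μ (e j z) := fun j z => by
    have : e j z ∈ μ ⁻¹' Set.range (Nat.pair j) := hr j ▸ Set.mem_range_self z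
    exact this
  refine ⟨(exists_prod_homeo e (fun n => (he n).isOpenEmbedding) ?_ ?_).choose⟩
  · intro i j m m' h
    obtain ⟨n, hn⟩ := hm i m
    obtain ⟨n', hn'⟩ := hm j m'
    rw [h, ← hn'] at hn
    exact (Nat.pair_eq_pair.1 hn).1
  · intro y
    have : y ∈ Set.range (e (Nat.unpair (μ y)).1) := by
      rw [hr]
      exact ⟨(Nat.unpair (μ y)).2, Nat.pair_unpair _⟩
    exact ⟨_, this⟩

/-- Decomposition into countably many copies of the space, the first one prescribed. -/
theorem exists_prod_self_of_infinite (hμ : IsBlockSpace μ) {S : Set ℕ} (hS : S.Infinite)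
    (hS' : Sᶜ.Infinite) :
    ∃ r : ℕ × Z ≃ₜ Z, (Set.range fun z => r (0, z)) = μ ⁻¹' S := by
  obtain ⟨c⟩ := hμ.exists_prod_self
  obtain ⟨a, ha, har⟩ := hμ.exists_clopenEmb hS
  obtain ⟨b, hb, hbr⟩ := hμ.exists_clopenEmb hS'
  have ha' : ∀ z, μ (a z) ∈ S := fun z => by
    have : a z ∈ μ ⁻¹' S := har ▸ Set.mem_range_self z
    exact this
  have hb' : ∀ z, μ (b z) ∉ S := fun z => by
    have : b z ∈ μ ⁻¹' Sᶜ := hbr ▸ Set.mem_range_self z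
    exact this
  let e : ℕ → Z → Z := fun n => Nat.casesOn n a fun k z => b (c (k, z))
  suffices h : ∃ r : ℕ × Z ≃ₜ Z, ∀ n m, r (n, m) = e n m by
    obtain ⟨r, hr⟩ := h
    exact ⟨r, by simp only [hr]; exact har⟩
  refine exists_prod_homeo e ?_ ?_ ?_
  · rintro (_ | k)
    · exact ha.isOpenEmbedding
    · exact (hb.comp ((IsClopenEmb.homeo c).comp (IsClopenEmb.slice k))).isOpenEmbedding
  · rintro (_ | i) (_ | j) m m' h
    · rfl
    · exact absurd ((congrArg μ h : μ (a m) = μ (b (c (j, m')))) ▸ ha' m) (hb' _)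
    · exact absurd ((congrArg μ h : μ (b (c (i, m))) = μ (a m')) ▸ ha' m') (hb' _)
    · have := c.injective (hb.injective h)
      rw [show i = j from (Prod.ext_iff.1 this).1]
  · intro y
    by_cases hy : μ y ∈ S
    · obtain ⟨z, hz⟩ : y ∈ Set.range a := har ▸ hy
      exact ⟨0, z, hz⟩
    · obtain ⟨z, hz⟩ : y ∈ Set.range b := hbr ▸ hy
      obtain ⟨⟨k, m⟩, rfl⟩ := c.surjective z
      exact ⟨k + 1, m, hz⟩

/-- In a set of homeomorphisms meeting `(φ a)⁻¹ φ b` for every family `φ` indexed by the subsets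
of `ℕ`, some element is the identity on a given compact set and maps a copy of the space inside
one clopen copy onto a copy inside another one. -/
theorem exists_mem_swap (hμ : IsBlockSpace μ) {V : Set (Z ≃ₜ Z)}
    (hV : ∀ φ : Set ℕ → (Z ≃ₜ Z), ∃ α β, α ≠ β ∧ (φ β).trans (φ α).symm ∈ V)
    {a b : Z → Z} (ha : IsClopenEmb a) (hb : IsClopenEmb b) {K : Set Z}
    (hK : IsCompact K) :
    ∃ u ∈ V, (∀ z ∈ K, u z = z) ∧
      ∃ κ : Z → Z, IsClopenEmb κ ∧ ∀ z, ∃ z', u (a z') = b (κ z) := by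
  obtain ⟨c⟩ := hμ.exists_prod_self
  obtain ⟨f, hfP, hfr⟩ := exists_seq_of_forall_finset_exists
    (fun p : ℕ × ℕ => (∀ z, μ z = p.1 → a z ∉ K) ∧ (∀ z, μ z = p.2 → b z ∉ K) ∧
      ∀ z z', μ z = p.1 → μ z' = p.2 → a z ≠ b z')
    (fun p q : ℕ × ℕ => p.1 < q.1 ∧ p.2 < q.2 ∧
      (∀ z z', μ z = p.1 → μ z' = q.2 → a z ≠ b z') ∧
      ∀ z z', μ z = q.1 → μ z' = p.2 → a z ≠ b z') (by
    intro s _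
    have hL : IsCompact (K ∪ ⋃ p ∈ s, (a '' {z | μ z = p.1} ∪ b '' {z | μ z = p.2})) :=
      hK.union (s.isCompact_biUnion fun p _ =>
        ((hμ.compact_eq _).image ha.isOpenEmbedding.continuous).union
          ((hμ.compact_eq _).image hb.isOpenEmbedding.continuous))
    obtain ⟨n, hn⟩ := hμ.exists_bound ha hL
    obtain ⟨n', hn'⟩ : ∃ n', ∀ p ∈ s, p.1 < n' ∧ p.2 < n' :=
      ⟨s.sup (fun p => p.1 + p.2) + 1, fun p hp => by
        have := Finset.le_sup (f := fun p : ℕ × ℕ => p.1 + p.2) hp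
        omega⟩
    have hL' := hL.union ((hμ.compact_eq (n + n')).image ha.isOpenEmbedding.continuous)
    obtain ⟨m, hm⟩ := hμ.exists_bound hb hL'
    refine ⟨(n + n', m + n'), ⟨?_, ?_, ?_⟩, ?_⟩
    · intro z hz hzK
      have := hn z (Or.inl hzK)
      simp only at hz
      omega
    · intro z hz hzK
      have := hm z (Or.inl (Or.inl hzK))
      simp only at hz
      omega
    · intro z z' hz hz' h
      have := hm z' (Or.inr ⟨z, hz, h⟩)
      simp only at hz'
      omega
    · intro p hp
      refine ⟨by have := hn' p hp; simp only; omega, by have := hn' p hp; simp only; omega, ?_, ?_⟩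
      · intro z z' hz hz' h
        have := hm z' (Or.inl (Or.inr (Set.mem_biUnion hp (Or.inl ⟨z, hz, h⟩))))
        simp only at hz'
        omega
      · intro z z' hz hz' h
        have := hn z (Or.inr (Set.mem_biUnion hp (Or.inr ⟨z', hz', h.symm⟩)))
        simp only at hz
        omega)
  have hab : ∀ j k z z', μ z = (f j).1 → μ z' = (f k).2 → a z ≠ b z' := by
    intro j k
    rcases lt_trichotomy j k with h | rfl | h
    · exact (hfr j k h).2.2.1
    · exact (hfP j).2.2
    · exact (hfr k j h).2.2.2
  have hi1 : StrictMono fun j => (f j).1 := fun j k h => (hfr j k h).1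
  have hi2 : StrictMono fun j => (f j).2 := fun j k h => (hfr j k h).2.1
  obtain ⟨e, he, her⟩ := hμ.exists_clopenEmb (Set.infinite_range_of_injective hi1.injective)
  obtain ⟨d, hd, hdr⟩ := hμ.exists_clopenEmb (Set.infinite_range_of_injective hi2.injective)
  have he' : ∀ z, ∃ j, μ (e z) = (f j).1 := fun z => by
    have : e z ∈ μ ⁻¹' _ := her ▸ Set.mem_range_self z
    obtain ⟨j, hj⟩ := this
    exact ⟨j, hj.symm⟩
  have hd' : ∀ z, ∃ j, μ (d z) = (f j).2 := fun z => by
    have : d z ∈ μ ⁻¹' _ := hdr ▸ Set.mem_range_self z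
    obtain ⟨j, hj⟩ := this
    exact ⟨j, hj.symm⟩
  have hA : IsClopenEmb fun p => a (e (c p)) := ha.comp (he.comp (IsClopenEmb.homeo c))
  have hB : IsClopenEmb fun p => b (d (c p)) := hb.comp (hd.comp (IsClopenEmb.homeo c))
  have hAB := hA.sumElim hB (fun p q => by
    obtain ⟨j, hj⟩ := he' (c p)
    obtain ⟨k, hk⟩ := hd' (c q)
    exact hab j k _ _ hj hk)
  have hKr : ∀ y ∈ K, y ∉ Set.range (Sum.elim (fun p => a (e (c p))) fun p => b (d (c p))) := by
    rintro y hy ⟨p | p, rfl⟩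
    · obtain ⟨j, hj⟩ := he' (c p)
      exact (hfP j).1 _ hj hy
    · obtain ⟨j, hj⟩ := hd' (c p)
      exact (hfP j).2.1 _ hj hy
  choose T hT1 hT2 using exists_swap_fibres Z
  choose φ hφ hφ' using fun J => hAB.exists_extend (T J)
  obtain ⟨α, β, hne, hmem⟩ := hV φ
  obtain ⟨j, hj⟩ : ∃ j, ¬ (j ∈ α ↔ j ∈ β) := by
    by_contra! hcon
    exact hne (Set.ext hcon)
  refine ⟨_, hmem, ?_, fun z => d (c (j, z)),
    hd.comp ((IsClopenEmb.homeo c).comp (IsClopenEmb.slice j)), fun z => ⟨e (c (j, z)), ?_⟩⟩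
  · intro z hz
    rw [Homeomorph.trans_apply, hφ' β z (hKr z hz), Homeomorph.symm_apply_eq,
      hφ' α z (hKr z hz)]
  · rw [Homeomorph.trans_apply, Homeomorph.symm_apply_eq]
    have h1 := hφ α (.inr (j, z))
    have h2 := hφ β (.inl (j, z))
    simp only [Sum.elim_inl, Sum.elim_inr] at h1 h2
    rw [h1, h2]
    by_cases hjα : j ∈ α
    · have hjβ : j ∉ β := fun hb => hj ⟨fun _ => hb, fun _ => hjα⟩
      rw [(hT1 α j z hjα).2, (hT2 β j z hjβ).1]
    · have hjβ : j ∈ β := by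
        by_contra hb
        exact hj ⟨fun h => absurd h hjα, fun h => absurd h hb⟩
      rw [(hT2 α j z hjα).2, (hT1 β j z hjβ).1]

end IsBlockSpace

/-! ### Separating all subsets of `ℕ` on a countable tree -/

/-- Numerical codes for the finite initial segments of subsets of `ℕ`. -/
theorem exists_codes : ∃ (code : Set ℕ → ℕ → ℕ) (len : ℕ → ℕ) (seg : ℕ → Set ℕ),
    (∀ β m, len (code β m) = m) ∧
    (∀ β m k, k < m → (k ∈ seg (code β m) ↔ k ∈ β)) ∧
    ∀ α β m, (∀ k < m, k ∈ α ↔ k ∈ β) → code α m = code β m := by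
  classical
  let dec : ℕ → ℕ × Finset ℕ := fun n => (Encodable.decode n).getD (0, ∅)
  have hdec : ∀ p : ℕ × Finset ℕ, dec (Encodable.encode p) = p := fun p => by
    simp only [dec, Encodable.encodek, Option.getD_some]
  refine ⟨fun β m => Encodable.encode (m, (Finset.range m).filter (· ∈ β)),
    fun n => (dec n).1, fun n => ((dec n).2 : Set ℕ), ?_, ?_, ?_⟩
  · intro β m
    simp only [hdec]
  · intro β m k hk
    simp only [hdec]
    simp [hk]
  · intro α β m h
    have : (Finset.range m).filter (· ∈ α) = (Finset.range m).filter (· ∈ β) :=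
      Finset.filter_congr fun k hk => h k (Finset.mem_range.1 hk)
    simp only [this]

/-- The involution attached to a subset `β` of `ℕ`: with `C` graded by `μ`, it moves the points
of `C` of index `m` to the node of the tree given by the first `m` values of `β`, and the nodes
which leave `β` at time `n` to a copy indexed by `n + 1`. The two properties describe the
nodes of the branch `α` as seen from `β`. -/
theorem exists_tree_involution {Z : Type*} [TopologicalSpace Z] {μ : Z → ℕ} (hμ : Continuous μ)
    {p : Z → Prop} (hp : IsClopen {z | p z}) :
    ∃ (code : Set ℕ → ℕ → ℕ)
      (τ : Set ℕ → ({z // p z} ⊕ (ℕ × (ℕ × Z)) ≃ₜ {z // p z} ⊕ (ℕ × (ℕ × Z)))),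
      (∀ β c, τ β (.inl c) = .inr (0, code β (μ c), c)) ∧ (∀ β q, τ β (τ β q) = q) ∧
      ∀ α β n, (∀ k < n, k ∈ α ↔ k ∈ β) → ¬ (n ∈ α ↔ n ∈ β) →
        ∀ c : {z // p z}, (μ c ≤ n → τ β (.inr (0, code α (μ c), c)) = .inl c) ∧
          (n < μ c → τ β (.inr (0, code α (μ c), c)) = .inr (n + 1, code α (μ c), c)) := by
  classical
  obtain ⟨code, len, seg, hlen, hseg, hcode⟩ := exists_codes
  let d : Set ℕ → ℕ → ℕ := fun β l => sInf {k | ¬ (k ∈ seg l ↔ k ∈ β)}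
  let g0 : Set ℕ → ℕ → Z → {z // p z} ⊕ (ℕ × (ℕ × Z)) := fun β l z =>
    if l = code β (len l) then
      (if h : p z ∧ μ z = len l then .inl ⟨z, h.1⟩ else .inr (0, l, z))
    else .inr (d β l + 1, l, z)
  let g1 : Set ℕ → ℕ → ℕ → Z → {z // p z} ⊕ (ℕ × (ℕ × Z)) := fun β n l z =>
    if l ≠ code β (len l) ∧ n = d β l then .inr (0, l, z) else .inr (n + 1, l, z)
  let f : Set ℕ → {z // p z} ⊕ (ℕ × (ℕ × Z)) → {z // p z} ⊕ (ℕ × (ℕ × Z)) := fun β =>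
    Sum.elim (fun c => .inr (0, code β (μ c), c)) fun q =>
      match q.1 with
      | 0 => g0 β q.2.1 q.2.2
      | n + 1 => g1 β n q.2.1 q.2.2
  have hc : ∀ β, Continuous (f β) := by
    intro β
    refine Continuous.sumElim ?_ ?_
    · have : Continuous fun c : {z // p z} => code β (μ c) :=
        (continuous_of_discreteTopology (f := code β)).comp (hμ.comp continuous_subtype_val)
      fun_prop
    · rw [continuous_prod_of_discrete_left]
      rintro (_ | n) <;> rw [continuous_prod_of_discrete_left] <;> intro l
      · change Continuous (g0 β l)
        by_cases hl : l = code β (len l)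
        · simp only [g0, if_pos hl]
          refine continuous_dite_of_isClopen ?_ ?_ ?_
          · exact hp.inter ((isClopen_discrete {len l}).preimage hμ)
          · exact continuous_inl.comp (continuous_subtype_val.subtype_mk _)
          · fun_prop
        · simp only [g0, if_neg hl]
          fun_prop
      · change Continuous (g1 β n l)
        by_cases hl : l ≠ code β (len l) ∧ n = d β l
        · simp only [g1, if_pos hl]
          fun_prop
        · simp only [g1, if_neg hl]
          fun_prop
  have hi : ∀ β, Function.Involutive (f β) := by
    rintro β (c | ⟨_ | n, l, z⟩)
    · change g0 β (code β (μ c)) c = _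
      have h1 : code β (μ c) = code β (len (code β (μ c))) := by rw [hlen]
      have h2 : p c ∧ μ c = len (code β (μ c)) := ⟨c.2, (hlen _ _).symm⟩
      simp only [g0]
      rw [if_pos h1, dif_pos h2]
    · change f β (g0 β l z) = _
      by_cases hl : l = code β (len l)
      · by_cases hz : p z ∧ μ z = len l
        · have : g0 β l z = .inl ⟨z, hz.1⟩ := by
            simp only [g0]
            rw [if_pos hl, dif_pos hz]
          rw [this]
          change Sum.inr (0, code β (μ z), z) = _
          rw [hz.2, ← hl]
        · have : g0 β l z = .inr (0, l, z) := by
            simp only [g0]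
            rw [if_pos hl, dif_neg hz]
          rw [this]
          exact this
      · have : g0 β l z = .inr (d β l + 1, l, z) := by
          simp only [g0]
          rw [if_neg hl]
        rw [this]
        exact if_pos ⟨hl, rfl⟩
    · change f β (g1 β n l z) = _
      by_cases hl : l ≠ code β (len l) ∧ n = d β l
      · have : g1 β n l z = .inr (0, l, z) := by
          simp only [g1]
          rw [if_pos hl]
        rw [this]
        change g0 β l z = _
        simp only [g0]
        rw [if_neg hl.1, hl.2]
      · have : g1 β n l z = .inr (n + 1, l, z) := by
          simp only [g1]
          rw [if_neg hl]
        rw [this]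
        exact this
  refine ⟨code, fun β => (hi β).toHomeo (hc β), fun β c => rfl, fun β q => hi β q, ?_⟩
  intro α β n hlt hn c
  constructor
  · intro hle
    have : code α (μ c) = code β (μ c) := hcode _ _ _ fun k hk => hlt k (hk.trans_le hle)
    rw [this]
    exact hi β (.inl c)
  · intro hm
    change g0 β (code α (μ c)) c = _
    have hne : code α (μ c) ≠ code β (len (code α (μ c))) := by
      rw [hlen]
      intro h
      apply hn
      rw [← hseg α _ n hm, h, hseg β _ n hm]
    have hd : d β (code α (μ c)) = n := by
      apply le_antisymm
      · refine Nat.sInf_le ?_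
        change ¬ (n ∈ seg (code α (μ c)) ↔ n ∈ β)
        rwa [hseg α _ n hm]
      · have hmem : n ∈ {k | ¬ (k ∈ seg (code α (μ c)) ↔ k ∈ β)} := by
          change ¬ (n ∈ seg (code α (μ c)) ↔ n ∈ β)
          rwa [hseg α _ n hm]
        refine le_csInf ⟨n, hmem⟩ fun k hk => ?_
        by_contra! hkn
        apply hk
        rw [hseg α _ k (hkn.trans hm)]
        exact hlt k hkn
    simp only [g0]
    rw [if_neg hne, hd]

/-- Given sets `M n` of points of index larger than `n`, each of them avoiding a copy of the space
inside the `n + 1`-st piece of a copy `A` of the space, some `M n` is mapped into `A` by some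
homeomorphism from `V`. -/
theorem exists_mem_mapsTo {Z : Type*} [TopologicalSpace Z] {μ : Z → ℕ} (hμ : Continuous μ)
    {V : Set (Z ≃ₜ Z)}
    (hV : ∀ φ : Set ℕ → (Z ≃ₜ Z), ∃ α β, α ≠ β ∧ (φ β).trans (φ α).symm ∈ V)
    (c : ℕ × Z ≃ₜ Z) {a : Z → Z} (ha : IsClopenEmb a) {κ : ℕ → Z → Z}
    (hκ : ∀ n, IsClopenEmb (κ n)) {M : ℕ → Set Z} (hM : ∀ n, ∀ z ∈ M n, n < μ z)
    (hM' : ∀ n, ∀ z ∈ M n, ∀ y, z ≠ a (c (n + 1, κ n y))) :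
    ∃ n, ∃ v ∈ V, ∀ z ∈ M n, v z ∈ Set.range a := by
  have hp : IsClopen {z | z ∉ Set.range a} :=
    (IsClopen.compl ⟨ha.isClosed_range, ha.isOpenEmbedding.isOpen_range⟩)
  obtain ⟨code, τ, hτl, hτi, hτ⟩ := exists_tree_involution hμ hp
  let κ' : ℕ → Z → Z := fun n => Nat.casesOn n id κ
  have hκ' : ∀ n, IsClopenEmb (κ' n) := by
    rintro (_ | n)
    · exact IsClopenEmb.homeo (Homeomorph.refl Z)
    · exact hκ n
  let Ψ : {z // z ∉ Set.range a} ⊕ (ℕ × (ℕ × Z)) → Z :=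
    Sum.elim Subtype.val fun q => a (c (q.1, κ' q.1 (c q.2)))
  have hΨ : IsClopenEmb Ψ := by
    refine IsClopenEmb.sumElim ⟨hp.isOpen.isOpenEmbedding_subtypeVal, ?_⟩ ?_ ?_
    · rw [Subtype.range_coe_subtype]
      exact hp.isClosed
    · exact ha.comp ((IsClopenEmb.homeo c).comp
        (IsClopenEmb.fibrewise fun n => (hκ' n).comp (IsClopenEmb.homeo c)))
    · intro z q h
      exact z.2 ⟨_, h.symm⟩
  choose φ hφ _ using fun β => hΨ.exists_extend (τ β)
  obtain ⟨α, β, hne, hmem⟩ := hV φ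
  have hex : ∃ j, ¬ (j ∈ α ↔ j ∈ β) := by
    by_contra! hcon
    exact hne (Set.ext hcon)
  classical
  refine ⟨Nat.find hex, _, hmem, fun z hz => ?_⟩
  by_contra hcon
  set y : {z // z ∉ Set.range a} := ⟨_, hcon⟩ with hy
  have hlt : ∀ k < Nat.find hex, k ∈ α ↔ k ∈ β := fun k hk => by
    simpa using Nat.find_min hex hk
  have h1 : φ β z = Ψ (.inr (0, code α (μ y), y)) := by
    rw [← hτl, ← hφ]
    exact ((φ α).apply_symm_apply _).symm
  have h2 : z = Ψ (τ β (.inr (0, code α (μ y), y))) := by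
    apply (φ β).injective
    rw [hφ, hτi, h1]
  obtain ⟨h3, h4⟩ := hτ α β _ hlt (Nat.find_spec hex) y
  rcases le_or_gt (μ y) (Nat.find hex) with hle | hgt
  · rw [h3 hle] at h2
    have := hM _ z hz
    rw [h2] at this
    exact absurd hle (not_le.2 this)
  · rw [h4 hgt] at h2
    exact hM' _ z hz _ h2

/-! ### Sets of homeomorphisms with countably many translates covering the group -/

section Covering

variable {X : Type*} [TopologicalSpace X]

theorem SuppOn.mem_iff {g : X ≃ₜ X} {Q : Set X} (hg : SuppOn g Q) (y : X) : y ∈ Q ↔ g y ∈ Q := by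
  by_cases hy : y ∈ Q
  · refine ⟨fun _ => ?_, fun _ => hy⟩
    by_contra h
    have := g.injective (hg _ h)
    exact h (this.symm ▸ hy)
  · rw [hg y hy]

variable {W : Set (X ≃ₜ X)}

theorem inv_mul_mem (hsym : W = W⁻¹) {g f f' : X ≃ₜ X} (hf : f ∈ g • W) (hf' : f' ∈ g • W) :
    f⁻¹ * f' ∈ W * W := by
  obtain ⟨w, hw, rfl⟩ := hf
  obtain ⟨w', hw', rfl⟩ := hf'
  refine ⟨w⁻¹, by rw [hsym]; exact Set.inv_mem_inv.2 hw, w', hw', ?_⟩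
  simp only [smul_eq_mul]
  group

theorem inv_mem_mul_self (hsym : W = W⁻¹) {w : X ≃ₜ X} (hw : w ∈ W * W) : w⁻¹ ∈ W * W := by
  rw [← Set.mem_inv, mul_inv_rev, ← hsym]
  exact hw

theorem one_mem_mul_self (hsym : W = W⁻¹) (hcov : ∃ g : ℕ → X ≃ₜ X, (⋃ i, g i • W) = Set.univ) :
    1 ∈ W * W := by
  obtain ⟨g, hg⟩ := hcov
  obtain ⟨i, hi⟩ := Set.mem_iUnion.1 (hg.symm ▸ Set.mem_univ (1 : X ≃ₜ X))
  simpa using inv_mul_mem hsym hi hi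

theorem exists_ne_inv_mul_mem (hsym : W = W⁻¹)
    (hcov : ∃ g : ℕ → X ≃ₜ X, (⋃ i, g i • W) = Set.univ) {α : Type*} [Uncountable α]
    (φ : α → X ≃ₜ X) : ∃ a b, a ≠ b ∧ (φ a)⁻¹ * φ b ∈ W * W := by
  obtain ⟨g, hg⟩ := hcov
  have hi : ∀ a, ∃ i, φ a ∈ g i • W := fun a =>
    Set.mem_iUnion.1 (hg.symm ▸ Set.mem_univ (φ a))
  choose i hi using hi
  have := not_injective_uncountable_countable i
  simp only [Function.Injective, not_forall] at this
  obtain ⟨a, b, hab, hne⟩ := this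
  exact ⟨a, b, hne, inv_mul_mem hsym (hi a) (hab ▸ hi b)⟩

theorem exists_lt_inv_mul_mem (hsym : W = W⁻¹)
    (hcov : ∃ g : ℕ → X ≃ₜ X, (⋃ i, g i • W) = Set.univ) {α : Type*} [LinearOrder α]
    [Uncountable α] (φ : α → X ≃ₜ X) : ∃ a b, a < b ∧ (φ a)⁻¹ * φ b ∈ W * W := by
  obtain ⟨a, b, hne, h⟩ := exists_ne_inv_mul_mem hsym hcov φ
  rcases hne.lt_or_gt with hlt | hlt
  · exact ⟨a, b, hlt, h⟩
  · refine ⟨b, a, hlt, ?_⟩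
    have := inv_mem_mul_self hsym h
    simpa using this

/-- On `Q`, every homeomorphism supported on `Q` agrees with some element of `W * W`. -/
def IsGood (W : Set (X ≃ₜ X)) (Q : Set X) : Prop :=
  ∀ g : X ≃ₜ X, SuppOn g Q → ∃ w ∈ W * W, ∀ y ∈ Q, w y = g y

theorem exists_isGood [CompactSpace X] [T2Space X] (hsym : W = W⁻¹)
    (hcov : ∃ g : ℕ → X ≃ₜ X, (⋃ i, g i • W) = Set.univ) {M : Type*} [TopologicalSpace M]
    (x : X) {e : ℕ × M → X} (he : IsOpenEmbedding e) (hc : IsClosed (insert x (Set.range e))) :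
    ∃ i, IsGood W (Set.range fun m => e (i, m)) := by
  obtain ⟨γ, hγ⟩ := hcov
  have key : ∃ i, ∀ g : X ≃ₜ X, SuppOn g (Set.range fun m => e (i, m)) →
      ∃ w ∈ γ i • W, ∀ m, w (e (i, m)) = g (e (i, m)) := by
    by_contra! hcon
    choose g hg hbad using hcon
    have hr : ∀ i, ∃ f : M ≃ₜ M, ∀ m, e (i, f m) = g i (e (i, m)) := fun i =>
      exists_restrict (e := fun m => e (i, m))
        (he.isEmbedding.comp (IsClopenEmb.slice i).isOpenEmbedding.isEmbedding) (g i)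
        (hg i).mem_iff
    choose f hf using hr
    obtain ⟨f', hf'⟩ := exists_prod_homeo (fun i m => (i, f i m))
      (fun i => (IsClopenEmb.slice i).isOpenEmbedding.comp (f i).isOpenEmbedding)
      (fun i j m m' h => (Prod.ext_iff.1 h).1)
      (fun y => ⟨y.1, (f y.1).symm y.2, by simp⟩)
    obtain ⟨F, hF, -⟩ := exists_extend x he hc f'
    obtain ⟨i, hi⟩ := Set.mem_iUnion.1 (hγ.symm ▸ Set.mem_univ F)
    obtain ⟨m, hm⟩ := hbad i F hi
    exact hm (by rw [hF, hf', hf])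
  obtain ⟨i, hi⟩ := key
  refine ⟨i, fun g hg => ?_⟩
  obtain ⟨w0, hw0, h0⟩ := hi (Homeomorph.refl X) fun y _ => rfl
  obtain ⟨w1, hw1, h1⟩ := hi g hg
  refine ⟨w0⁻¹ * w1, inv_mul_mem hsym hw0 hw1, ?_⟩
  rintro y ⟨m, rfl⟩
  change w0.symm (w1 (e (i, m))) = _
  rw [Homeomorph.symm_apply_eq]
  dsimp only
  rw [h1]
  obtain ⟨m', hm'⟩ := (hg.mem_iff _).1 ⟨m, rfl⟩
  dsimp only at hm'
  rw [← hm']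
  exact (h0 m').symm

/-- An infinite-swindle: a homeomorphism supported on the first of countably many copies of a
space is a commutator when all the copies can be moved into a good set. -/
theorem mem_pow_of_isGood [CompactSpace X] [T2Space X] (hsym : W = W⁻¹)
    (hcov : ∃ g : ℕ → X ≃ₜ X, (⋃ i, g i • W) = Set.univ) {M : Type*} [TopologicalSpace M]
    (x : X) {p : ℕ × M → X} (hp : IsOpenEmbedding p) (hc : IsClosed (insert x (Set.range p)))
    {h : X ≃ₜ X} {h0 : M ≃ₜ M} (hh : ∀ m, h (p (0, m)) = p (0, h0 m))
    (hh' : ∀ y, y ∉ (Set.range fun m => p (0, m)) → h y = y) {Q : Set X} (hQ : IsGood W Q)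
    {ρ : X ≃ₜ X} (hρ : ρ ∈ W ^ 6) (hρQ : ∀ q, ρ (p q) ∈ Q) : h ∈ W ^ 24 := by
  classical
  have hf : ∀ S : Set ℕ, ∃ f : ℕ × M ≃ₜ ℕ × M,
      ∀ k m, f (k, m) = (k, if k ∈ S then h0 m else m) := fun S => by
    refine exists_prod_homeo (fun k m => (k, if k ∈ S then h0 m else m)) (fun k => ?_)
      (fun i j m m' h => (Prod.ext_iff.1 h).1) (fun y => ?_)
    · by_cases hk : k ∈ S
      · simp only [hk, if_true]
        exact (IsClopenEmb.slice k).isOpenEmbedding.comp h0.isOpenEmbedding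
      · simp only [hk, if_false]
        exact (IsClopenEmb.slice k).isOpenEmbedding
    · by_cases hk : y.1 ∈ S
      · exact ⟨y.1, h0.symm y.2, by simp [hk]⟩
      · exact ⟨y.1, y.2, by simp [hk]⟩
  choose f hf using hf
  choose F hF hF' using fun S => exists_extend x hp hc (f S)
  have hFp : ∀ S k m, F S (p (k, m)) = p (k, if k ∈ S then h0 m else m) := fun S k m => by
    rw [hF, hf]
  obtain ⟨q⟩ : Nonempty (ℕ ≃ ℚ) := ⟨(Denumerable.eqv ℚ).symm⟩
  let J : ℝ → Set ℕ := fun r => {k | ∃ m, k = m + 1 ∧ (q m : ℝ) < r}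
  obtain ⟨r, r', hlt, hmem⟩ := exists_lt_inv_mul_mem hsym hcov fun r => ρ * F (J r) * ρ⁻¹
  set E : Set ℕ := J r' \ J r with hE
  have hE0 : 0 ∉ E := fun h => by
    obtain ⟨m, hm, -⟩ := h.1
    omega
  have hE1 : E.Infinite := by
    have hsub : (fun m => m + 1) '' (q ⁻¹' {s : ℚ | r < s ∧ (s : ℝ) < r'}) ⊆ E := by
      rintro _ ⟨m, hm, rfl⟩
      refine ⟨⟨m, rfl, hm.2⟩, ?_⟩
      rintro ⟨m', hm', hlt'⟩
      obtain rfl : m = m' := Nat.succ_injective hm'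
      exact absurd hlt' (not_lt.2 hm.1.le)
    refine Set.Infinite.mono hsub (Set.Infinite.image (fun a _ b _ h => by simpa using h) ?_)
    refine Set.Infinite.preimage ?_ fun s _ => q.surjective s
    obtain ⟨s, hs, hs'⟩ := exists_rat_btwn hlt
    obtain ⟨s', ht, ht'⟩ := exists_rat_btwn hs'
    refine (Set.Ioo_infinite (a := s) (b := s') (by exact_mod_cast ht)).mono fun y hy => ?_
    exact ⟨hs.trans (by exact_mod_cast hy.1), lt_trans (by exact_mod_cast hy.2) ht'⟩
  have hE2 : (insert 0 E)ᶜ.Infinite := by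
    have hsub : (fun m => m + 1) '' (q ⁻¹' {s : ℚ | (s : ℝ) < r}) ⊆ (insert 0 E)ᶜ := by
      rintro _ ⟨m, hm, rfl⟩ h
      rcases h with h | h
      · exact absurd h (Nat.succ_ne_zero m)
      · exact h.2 ⟨m, rfl, hm⟩
    refine Set.Infinite.mono hsub (Set.Infinite.image (fun a _ b _ h => by simpa using h) ?_)
    refine Set.Infinite.preimage ?_ fun s _ => q.surjective s
    obtain ⟨s, hs⟩ := exists_rat_lt r
    exact (Set.Iio_infinite s).mono fun y hy => lt_trans (by exact_mod_cast hy) hs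
  have hE3 : Eᶜ.Infinite := hE2.mono (Set.compl_subset_compl.2 (Set.subset_insert _ _))
  obtain ⟨π, hπ⟩ : ∃ π : ℕ ≃ ℕ, ∀ k, π k ∈ insert 0 E ↔ k ∈ E := by
    have := hE1.to_subtype
    have := hE2.to_subtype
    have := hE3.to_subtype
    have := (hE1.mono (Set.subset_insert 0 E)).to_subtype
    obtain ⟨e1⟩ : Nonempty (E ≃ (insert 0 E : Set ℕ)) := nonempty_equiv_of_countable
    obtain ⟨e2⟩ : Nonempty ((Eᶜ : Set ℕ) ≃ ((insert 0 E)ᶜ : Set ℕ)) := nonempty_equiv_of_countable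
    refine ⟨Equiv.subtypeCongr (p := (· ∈ E)) (q := (· ∈ insert 0 E)) e1 e2, fun k => ?_⟩
    by_cases hk : k ∈ E
    · simp only [hk, iff_true]
      have h1 : Equiv.subtypeCongr (p := (· ∈ E)) (q := (· ∈ insert 0 E)) e1 e2 k = e1 ⟨k, hk⟩ := by
        simp [Equiv.subtypeCongr, hk]
      rw [h1]
      exact (e1 ⟨k, hk⟩).2
    · simp only [hk, iff_false]
      have h1 : Equiv.subtypeCongr (p := (· ∈ E)) (q := (· ∈ insert 0 E)) e1 e2 k = e2 ⟨k, hk⟩ := by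
        simp [Equiv.subtypeCongr, hk]
      rw [h1]
      exact (e2 ⟨k, hk⟩).2
  obtain ⟨s, hs⟩ := exists_prod_homeo (fun k (m : M) => (π k, m))
    (fun k => (IsClopenEmb.slice (π k)).isOpenEmbedding)
    (fun i j m m' h => π.injective (Prod.ext_iff.1 h).1)
    (fun y => ⟨π.symm y.1, y.2, by simp⟩)
  obtain ⟨T, hT, hT'⟩ := exists_extend x hp hc s
  obtain ⟨w, hw, hwQ⟩ := hQ (ρ * T * ρ⁻¹) (fun y hy => by
    change ρ (T (ρ.symm y)) = y
    rw [hT', Homeomorph.apply_symm_apply]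
    rintro ⟨q, hq⟩
    apply hy
    have := hρQ q
    rwa [hq, Homeomorph.apply_symm_apply] at this)
  have hwp : ∀ k m, w (ρ (p (k, m))) = ρ (p (π k, m)) := fun k m => by
    rw [hwQ _ (hρQ _)]
    change ρ (T (ρ.symm (ρ _))) = _
    rw [Homeomorph.symm_apply_apply, hT, hs]
  have hwp' : ∀ y, y ∉ Set.range p → ρ.symm (w (ρ y)) ∉ Set.range p := by
    rintro y hy ⟨⟨k, m⟩, hkm⟩
    apply hy
    refine ⟨(π.symm k, m), ρ.injective (w.injective ?_)⟩
    rw [hwp, Equiv.apply_symm_apply, hkm, Homeomorph.apply_symm_apply]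
  have hFE : ρ * F E * ρ⁻¹ ∈ W * W := by
    convert hmem using 1
    have : F E = (F (J r))⁻¹ * F (J r') := by
      rw [eq_inv_mul_iff_mul_eq]
      ext y
      change F (J r) (F E y) = F (J r') y
      by_cases hy : y ∈ Set.range p
      · obtain ⟨⟨k, m⟩, rfl⟩ := hy
        rw [hFp, hFp, hFp]
        by_cases h1 : k ∈ J r
        · have h2 : k ∈ J r' := by
            obtain ⟨n, hn, hn'⟩ := h1
            exact ⟨n, hn, hn'.trans hlt⟩
          have h3 : k ∉ E := fun h => h.2 h1
          simp [h1, h2, h3]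
        · by_cases h2 : k ∈ J r'
          · have h3 : k ∈ E := ⟨h2, h1⟩
            simp [h1, h2, h3]
          · have h3 : k ∉ E := fun h => h2 h.1
            simp [h1, h2, h3]
      · rw [hF' E y hy, hF' _ y hy, hF' _ y hy]
    rw [this]
    group
  have hconj : w * (ρ * F E * ρ⁻¹) * w⁻¹ = ρ * F (insert 0 E) * ρ⁻¹ := by
    rw [mul_inv_eq_iff_eq_mul]
    ext y
    obtain ⟨y, rfl⟩ := ρ.surjective y
    change w (ρ (F E (ρ.symm (ρ y)))) = ρ (F (insert 0 E) (ρ.symm (w (ρ y))))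
    rw [Homeomorph.symm_apply_apply]
    by_cases hy : y ∈ Set.range p
    · obtain ⟨⟨k, m⟩, rfl⟩ := hy
      rw [hFp, hwp, hwp, Homeomorph.symm_apply_apply, hFp]
      by_cases hk : k ∈ E
      · rw [if_pos hk, if_pos ((hπ k).2 hk)]
      · rw [if_neg hk, if_neg fun h => hk ((hπ k).1 h)]
    · rw [hF' E y hy, hF' _ _ (hwp' y hy), Homeomorph.apply_symm_apply]
  have hmul : h * F E = F (insert 0 E) := by
    ext y
    change h (F E y) = F (insert 0 E) y
    by_cases hy : y ∈ Set.range p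
    · obtain ⟨⟨_ | k, m⟩, rfl⟩ := hy
      · rw [hFp, hFp, if_neg hE0, if_pos (Set.mem_insert 0 E), hh]
      · rw [hFp, hFp, hh']
        · by_cases hk : k + 1 ∈ E
          · rw [if_pos hk, if_pos (Set.mem_insert_of_mem 0 hk)]
          · rw [if_neg hk, if_neg fun h => h.elim (Nat.succ_ne_zero k) hk]
        · rintro ⟨m', hm'⟩
          have := hp.injective hm'
          simp at this
    · rw [hF' E y hy, hF' _ y hy, hh']
      rintro ⟨m, rfl⟩
      exact hy ⟨_, rfl⟩
  have hfin : h = ρ⁻¹ * w * (ρ * F E * ρ⁻¹) * w⁻¹ * (ρ * F E * ρ⁻¹)⁻¹ * ρ * 1 * 1 := by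
    have h1 : h = F (insert 0 E) * (F E)⁻¹ := by rw [← hmul]; group
    have h2 : F (insert 0 E) = ρ⁻¹ * (w * (ρ * F E * ρ⁻¹) * w⁻¹) * ρ := by rw [hconj]; group
    rw [h1, h2]
    group
  have hpow : W ^ 24 =
      W ^ 6 * (W * W) * (W * W) * (W * W) * (W * W) * W ^ 6 * (W * W) * (W * W) := by
    simp only [← pow_two, ← pow_add]
  have hρ' : ρ⁻¹ ∈ W ^ 6 := by
    rw [← Set.mem_inv, ← inv_pow, ← hsym]
    exact hρ
  have h1 := one_mem_mul_self hsym hcov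
  rw [hpow, hfin]
  exact Set.mul_mem_mul (Set.mul_mem_mul (Set.mul_mem_mul (Set.mul_mem_mul (Set.mul_mem_mul
    (Set.mul_mem_mul (Set.mul_mem_mul hρ' hw) hFE) (inv_mem_mul_self hsym hw))
    (inv_mem_mul_self hsym hFE)) hρ) h1) h1

/-- If `W * W` is dense in the homeomorphisms supported on `Ω`, it contains a homeomorphism which
preserves `Ω` and moves one clopen subset of `Ω` into a disjoint copy. -/
theorem exists_mem_mul_self_mapsTo [CompactSpace X] [T2Space X] {Ω : Set X} (hΩ : IsClopen Ω)
    (hdense : suppIn Ω ⊆ closure (W * W)) {M : Type*} [TopologicalSpace M] [CompactSpace M]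
    {u a : M → X} (hu : IsOpenEmbedding u) (ha : IsOpenEmbedding a) (huΩ : ∀ m, u m ∈ Ω)
    (haΩ : ∀ m, a m ∈ Ω) (hua : ∀ m m', u m ≠ a m') :
    ∃ w ∈ W * W, (∀ m, w (u m) ∈ Set.range a) ∧ ∀ y, y ∈ Ω ↔ w y ∈ Ω := by
  have hcl : ∀ {e : M → X}, IsOpenEmbedding e → IsClopenEmb e := fun he =>
    ⟨he, (isCompact_range he.continuous).isClosed⟩
  obtain ⟨s, hs, hs'⟩ := ((hcl hu).sumElim (hcl ha) hua).exists_extend (Homeomorph.sumComm M M)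
  have hsΩ : SuppOn s Ω := fun y hy => hs' y (by
    rintro ⟨m | m, rfl⟩
    · exact hy (huΩ m)
    · exact hy (haΩ m))
  have hopen : ∀ K U : Set X, IsCompact K → IsOpen U → IsOpen {f : X ≃ₜ X | Set.MapsTo f K U} :=
    fun K U hK hU => (ContinuousMap.isOpen_setOfPred_mapsTo hK hU).preimage
      (continuous_induced_dom (f := fun f : X ≃ₜ X => (f : C(X, X))))
  obtain ⟨w, ⟨⟨h1, h2⟩, h3⟩, hw⟩ := mem_closure_iff.1 (hdense hsΩ) _
    (((hopen (Set.range u) (Set.range a) (isCompact_range hu.continuous) ha.isOpen_range).inter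
      (hopen Ω Ω hΩ.isClosed.isCompact hΩ.isOpen)).inter
      (hopen Ωᶜ Ωᶜ hΩ.compl.isClosed.isCompact hΩ.compl.isOpen)) (by
      refine ⟨⟨?_, fun y hy => (hsΩ.mem_iff y).1 hy⟩, fun y hy h => hy ((hsΩ.mem_iff y).2 h)⟩
      rintro _ ⟨m, rfl⟩
      exact ⟨m, (hs (.inl m)).symm⟩)
  refine ⟨w, hw, fun m => h1 ⟨m, rfl⟩, fun y => ⟨fun hy => h2 hy, fun hy => ?_⟩⟩
  by_contra hcon
  exact h3 hcon hy

end Covering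

/-! ### Moving countably many copies into a good set -/

theorem exists_blockIndex {X : Type*} [TopologicalSpace X] [CompactSpace X] {x : X} {Ω : Set X}
    {Y : ℕ → Set X} (hY : IsStableDecomp x Ω Y) :
    ∃ μ : (Ω \ {x} : Set X) → ℕ, IsBlockSpace μ ∧ ∀ (z : (Ω \ {x} : Set X)) k, (z : X) ∈ Y k ↔ μ z = k := by
  have hex : ∀ z : (Ω \ {x} : Set X), ∃ k, (z : X) ∈ Y k := fun z =>
    Set.mem_iUnion.1 (hY.union ▸ z.2)
  have hsub : ∀ k, Y k ⊆ Ω \ {x} := fun k => by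
    rw [hY.union]
    exact Set.subset_iUnion Y k
  choose μ hμ using hex
  have hiff : ∀ (z : (Ω \ {x} : Set X)) k, (z : X) ∈ Y k ↔ μ z = k := fun z k => by
    refine ⟨fun hz => ?_, fun hz => hz ▸ hμ z⟩
    by_contra hne
    exact Set.disjoint_left.1 (hY.disj _ _ hne) (hμ z) hz
  have hopen : IsOpen (Ω \ {x}) := by
    rw [hY.union]
    exact isOpen_iUnion fun k => (hY.clopen k).isOpen
  refine ⟨μ, ⟨?_, ?_, ?_⟩, hiff⟩
  · rw [continuous_discrete_rng]
    intro k
    have : μ ⁻¹' {k} = Subtype.val ⁻¹' Y k := Set.ext fun z => (hiff z k).symm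
    rw [this]
    exact (hY.clopen k).isOpen.preimage continuous_subtype_val
  · intro n
    rw [IsInducing.subtypeVal.isCompact_iff]
    have : Subtype.val '' {z | μ z ≤ n} = ⋃ k ∈ Set.Iic n, Y k := by
      ext y
      simp only [Set.mem_iUnion]
      constructor
      · rintro ⟨z, hz, rfl⟩
        exact ⟨μ z, hz, hμ z⟩
      · rintro ⟨k, hk, hy⟩
        refine ⟨⟨y, hsub k hy⟩, ?_, rfl⟩
        have := (hiff ⟨y, hsub k hy⟩ k).1 hy
        exact this.trans_le hk
    rw [this]
    exact ((Set.finite_Iic n).isClosed_biUnion fun k _ => (hY.clopen k).isClosed).isCompact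
  · intro κ hκ
    obtain ⟨Φ⟩ := hY.subseq κ hκ
    have hs : (⋃ n, Y (κ n)) ⊆ Ω \ {x} := Set.iUnion_subset fun n => hsub _
    have ho : IsOpen (⋃ n, Y (κ n)) := isOpen_iUnion fun n => (hY.clopen _).isOpen
    refine ⟨fun z => ⟨Φ z, hs (Φ z).2⟩, ?_, ?_⟩
    · refine IsOpenEmbedding.of_comp _ hopen.isOpenEmbedding_subtypeVal ?_
      exact ho.isOpenEmbedding_subtypeVal.comp Φ.isOpenEmbedding
    · ext z
      constructor
      · rintro ⟨y, rfl⟩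
        obtain ⟨n, hn⟩ := Set.mem_iUnion.1 (Φ y).2
        exact ⟨n, ((hiff _ _).1 hn).symm⟩
      · rintro ⟨n, hn⟩
        have hz : (z : X) ∈ ⋃ n, Y (κ n) := Set.mem_iUnion.2 ⟨n, hn ▸ hμ z⟩
        exact ⟨Φ.symm ⟨z, hz⟩, by simp⟩

theorem isClosed_insert_range_comp {X Z M : Type*} [TopologicalSpace X] [T1Space X]
    [TopologicalSpace Z] [TopologicalSpace M] {x : X} {ι : Z → X} (hι : IsOpenEmbedding ι)
    (hc : IsClosed (insert x (Set.range ι))) {e : M → Z} (he : IsClopenEmb e) :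
    IsClosed (insert x (Set.range (ι ∘ e))) := by
  obtain ⟨C, hC, hCe⟩ := hι.isInducing.isClosed_iff.1 he.isClosed_range
  have : insert x (Set.range (ι ∘ e)) = insert x (Set.range ι) ∩ (insert x C) := by
    rw [Set.range_comp, ← hCe, Set.image_preimage_eq_inter_range]
    ext y
    simp only [Set.mem_insert_iff, Set.mem_inter_iff]
    tauto
  rw [this]
  exact hc.inter (Set.insert_eq x C ▸ isClosed_singleton.union hC)

section Move

variable {X Z : Type*} [TopologicalSpace X] [CompactSpace X] [T2Space X] [TopologicalSpace Z]
  {W : Set (X ≃ₜ X)} {Ω : Set X} {x : X} {ι : Z → X}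

theorem exists_inducing_mem (hsym : W = W⁻¹)
    (hcov : ∃ g : ℕ → X ≃ₜ X, (⋃ i, g i • W) = Set.univ) (hι : IsOpenEmbedding ι)
    (hc : IsClosed (insert x (Set.range ι))) (φ : Set ℕ → (Z ≃ₜ Z)) :
    ∃ α β, α ≠ β ∧ (φ β).trans (φ α).symm ∈
      {f : Z ≃ₜ Z | ∃ w ∈ W * W, ∀ z, w (ι z) = ι (f z)} := by
  choose F hF _ using fun α => exists_extend x hι hc (φ α)
  have : Uncountable (Set ℕ) := by
    rw [← not_countable_iff]
    intro h
    obtain ⟨f, hf⟩ := h.exists_injective_nat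
    exact Function.cantor_injective f hf
  obtain ⟨α, β, hne, hw⟩ := exists_ne_inv_mul_mem hsym hcov F
  refine ⟨α, β, hne, _, hw, fun z => ?_⟩
  change (F α).symm (F β (ι z)) = ι ((φ α).symm (φ β z))
  rw [Homeomorph.symm_apply_eq, hF, hF, Homeomorph.apply_symm_apply]

/-- If `Ω` embeds in `Ω \ {x}`, a compact good set can be found away from the given copies. -/
theorem exists_isGood_move_of_embedding (hsym : W = W⁻¹)
    (hcov : ∃ g : ℕ → X ≃ₜ X, (⋃ i, g i • W) = Set.univ) (hΩ : IsClopen Ω)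
    (hdense : suppIn Ω ⊆ closure (W * W)) (hι : IsOpenEmbedding ι)
    (hιr : Set.range ι = Ω \ {x}) (hc : IsClosed (insert x (Set.range ι))) (c : ℕ × Z ≃ₜ Z)
    {p : ℕ × Z → Z} {l : Z → Z} (hl : IsClopenEmb l) (hpl : ∀ q z, p q ≠ l z)
    {e : Ω → X} (he : IsOpenEmbedding e) (hex : ∀ y, e y ∈ Ω \ {x}) :
    ∃ Q, IsGood W Q ∧ ∃ ρ ∈ W * W, ∀ q, ρ (ι (p q)) ∈ Q := by
  have : CompactSpace Ω := isCompact_iff_compactSpace.1 hΩ.isClosed.isCompact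
  have : T2Space Z := hι.isEmbedding.t2Space
  have hιΩ : ∀ z, ι z ∈ Ω := fun z => (hιr ▸ Set.mem_range_self z : ι z ∈ Ω \ {x}).1
  have hd : ∀ y, ∃ z, ι z = e y := fun y => by
    have := hex y
    rwa [← hιr] at this
  choose d hd using hd
  have hd' : IsOpenEmbedding d := IsOpenEmbedding.of_comp d hι (by
    rw [show ι ∘ d = e from funext hd]
    exact he)
  have hd'' : IsClopenEmb d := ⟨hd', (isCompact_range hd'.continuous).isClosed⟩
  have hg : IsClopenEmb fun q : ℕ × Ω => l (c (q.1, d q.2)) :=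
    hl.comp ((IsClopenEmb.homeo c).comp (IsClopenEmb.fibrewise fun _ => hd''))
  obtain ⟨i, hi⟩ := exists_isGood hsym hcov x (hι.comp hg.isOpenEmbedding)
    (isClosed_insert_range_comp hι hc hg)
  simp only [Function.comp_apply] at hi
  refine ⟨_, hi, ?_⟩
  have ha : IsOpenEmbedding fun y : Ω => ι (l (c (i, d y))) :=
    hι.comp (hg.comp (IsClopenEmb.slice i)).isOpenEmbedding
  set Q : Set X := Set.range fun y : Ω => ι (l (c (i, d y))) with hQ
  have hQc : IsClopen Q := ⟨(isCompact_range ha.continuous).isClosed, ha.isOpen_range⟩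
  have hU : IsClopen (Ω \ Q) := hΩ.diff hQc
  have : CompactSpace (Ω \ Q : Set X) := isCompact_iff_compactSpace.1 hU.isClosed.isCompact
  have hinc : IsOpenEmbedding fun y : (Ω \ Q : Set X) => (⟨y, y.2.1⟩ : Ω) :=
    IsOpenEmbedding.of_comp _ hΩ.isOpen.isOpenEmbedding_subtypeVal
      hU.isOpen.isOpenEmbedding_subtypeVal
  obtain ⟨w, hw, hw1, -⟩ := exists_mem_mul_self_mapsTo hΩ hdense
    hU.isOpen.isOpenEmbedding_subtypeVal (ha.comp hinc) (fun y => y.2.1) (fun y => hιΩ _)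
    (fun y y' h => y.2.2 (h ▸ ⟨_, rfl⟩))
  refine ⟨w, hw, fun q => ?_⟩
  have hq : ι (p q) ∈ Ω \ Q := by
    refine ⟨hιΩ _, ?_⟩
    rintro ⟨y, hy⟩
    exact hpl _ _ (hι.injective hy).symm
  obtain ⟨y, hy⟩ := hw1 ⟨_, hq⟩
  exact ⟨_, hy⟩

/-- If all homeomorphisms preserving `Ω` fix `x`, the given copies can be moved into a good
set accumulating at `x`. -/
theorem exists_isGood_move_of_fixed (hsym : W = W⁻¹)
    (hcov : ∃ g : ℕ → X ≃ₜ X, (⋃ i, g i • W) = Set.univ) (hΩ : IsClopen Ω)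
    (hdense : suppIn Ω ⊆ closure (W * W)) (hι : IsOpenEmbedding ι)
    (hιr : Set.range ι = Ω \ {x}) (hc : IsClosed (insert x (Set.range ι)))
    {μ : Z → ℕ} (hμ : IsBlockSpace μ) (c : ℕ × Z ≃ₜ Z)
    {p : ℕ × Z → Z} {l : Z → Z} (hl : IsClopenEmb l) (hpl : ∀ q z, p q ≠ l z)
    (hfix : ∀ w : X ≃ₜ X, (∀ y, y ∈ Ω ↔ w y ∈ Ω) → w x = x) :
    ∃ Q, IsGood W Q ∧ ∃ ρ ∈ (W * W) * (W * W) * (W * W), ∀ q, ρ (ι (p q)) ∈ Q := by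
  have hιΩ : ∀ z, ι z ∈ Ω := fun z => (hιr ▸ Set.mem_range_self z : ι z ∈ Ω \ {x}).1
  obtain ⟨i, hi⟩ := exists_isGood hsym hcov x
    (hι.comp (IsClopenEmb.homeo c).isOpenEmbedding)
    (isClosed_insert_range_comp hι hc (IsClopenEmb.homeo c))
  refine ⟨_, hi, ?_⟩
  set V : Set (Z ≃ₜ Z) := {f : Z ≃ₜ Z | ∃ w ∈ W * W, ∀ z, w (ι z) = ι (f z)} with hVdef
  have hV := exists_inducing_mem hsym hcov hι hc
  have hδ : ∀ n, ∃ δ ∈ V, ∀ q, n < μ (δ (p q)) := by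
    intro n
    obtain ⟨j, hj⟩ := (hl.comp (IsClopenEmb.homeo c)).exists_slice_disjoint (hμ.compact n)
    have hlj : IsClopenEmb fun z => l (c (j, z)) :=
      hl.comp ((IsClopenEmb.homeo c).comp (IsClopenEmb.slice j))
    have : CompactSpace {z | μ z ≤ n} := isCompact_iff_compactSpace.1 (hμ.compact n)
    have hval : IsOpenEmbedding (Subtype.val : {z | μ z ≤ n} → Z) :=
      (hμ.isClopen_preimage (Set.Iic n)).isOpen.isOpenEmbedding_subtypeVal
    obtain ⟨w, hw, hw1, hw2⟩ := exists_mem_mul_self_mapsTo hΩ hdense (hι.comp hval)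
      (hι.comp (hlj.isOpenEmbedding.comp hval)) (fun _ => hιΩ _) (fun _ => hιΩ _)
      (fun y y' h => hj y' (by
        have : (y : Z) = l (c (j, y')) := hι.injective h
        exact (this ▸ y.2 : l (c (j, y')) ∈ {z | μ z ≤ n})))
    have hwx := hfix w hw2
    obtain ⟨f, hf⟩ := exists_restrict hι.isEmbedding w (fun y => by
      rw [hιr]
      refine and_congr (hw2 y) (not_congr ?_)
      simp only [Set.mem_singleton_iff]
      constructor
      · rintro rfl
        exact hwx
      · exact fun h => w.injective (h.trans hwx.symm))
    refine ⟨f.symm, ⟨w⁻¹, inv_mem_mul_self hsym hw, fun z => ?_⟩, fun q => ?_⟩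
    · change w.symm (ι z) = _
      rw [Homeomorph.symm_apply_eq, ← hf, Homeomorph.apply_symm_apply]
    · by_contra! hle
      obtain ⟨y, hy⟩ := hw1 ⟨_, hle⟩
      simp only [Function.comp_apply] at hy
      rw [← hf, Homeomorph.apply_symm_apply] at hy
      exact hpl _ _ (hι.injective hy).symm
  choose δ hδV hδ using hδ
  choose u huV huK κ hκ hu using fun n => hμ.exists_mem_swap hV
    ((IsClopenEmb.homeo (δ n)).comp hl)
    ((IsClopenEmb.homeo c).comp ((IsClopenEmb.slice i).comp
      ((IsClopenEmb.homeo c).comp (IsClopenEmb.slice (n + 1))))) (hμ.compact n)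
  obtain ⟨n, v, ⟨w, hw, hwv⟩, hv⟩ := exists_mem_mapsTo hμ.continuous hV c
    ((IsClopenEmb.homeo c).comp (IsClopenEmb.slice i)) hκ
    (M := fun n => {z | ∃ q, z = u n (δ n (p q))}) (by
      rintro n _ ⟨q, rfl⟩
      by_contra! hle
      have h1 := (u n).injective (huK n _ hle)
      rw [h1] at hle
      exact absurd (hδ n q) (not_lt.2 hle)) (by
      rintro n _ ⟨q, rfl⟩ y h
      obtain ⟨z, hz⟩ := hu n y
      exact hpl q z ((δ n).injective ((u n).injective (h.trans hz.symm))))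
  obtain ⟨w1, hw1, hwu⟩ := huV n
  obtain ⟨w2, hw2, hwδ⟩ := hδV n
  refine ⟨w * w1 * w2, Set.mul_mem_mul (Set.mul_mem_mul hw hw1) hw2, fun q => ?_⟩
  change w (w1 (w2 (ι (p q)))) ∈ _
  rw [hwδ, hwu, hwv]
  obtain ⟨y, hy⟩ := hv _ ⟨q, rfl⟩
  exact ⟨y, congrArg ι hy⟩

end Move

/-- Lemma 3.16 (pigeonhole): if `W` is symmetric, countably many left translates of `W`
cover `Homeo(X)`, and `G(Ω)` lies in the closure of `W * W`, then every homeomorphism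
fixing `x` that is supported on a brick lies in `W ^ 24`. -/
theorem brick_supported_mem_pow (X : Type*) [TopologicalSpace X] [CompactSpace X]
    [TopologicalSpace.MetrizableSpace X] [TotallyDisconnectedSpace X] [Nonempty X]
    (x : X) (Ω : Set X) (hΩ : IsStableNbhd x Ω) (Y : ℕ → Set X)
    (hY : IsStableDecomp x Ω Y)
    (W : Set (X ≃ₜ X)) (hsym : W = W⁻¹)
    (hcov : ∃ g : ℕ → X ≃ₜ X, (⋃ i, g i • W) = Set.univ)
    (hdense : suppIn Ω ⊆ closure (W * W))
    (h : X ≃ₜ X) (hx : h x = x) (hsupp : ∃ B : Set X, IsBrick Y B ∧ SuppOn h B) :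
    h ∈ W ^ 24 := by
  obtain ⟨B, ⟨S, hS, hS', rfl⟩, hB⟩ := hsupp
  obtain ⟨μ, hμ, hμY⟩ := exists_blockIndex hY
  have hxΩ : x ∈ Ω := mem_of_mem_nhds hΩ.2.1
  have hιr : Set.range (Subtype.val : (Ω \ {x} : Set X) → X) = Ω \ {x} := Subtype.range_val
  have hι : IsOpenEmbedding (Subtype.val : (Ω \ {x} : Set X) → X) :=
    (hΩ.1.isOpen.sdiff isClosed_singleton).isOpenEmbedding_subtypeVal
  have hc : IsClosed (insert x (Set.range (Subtype.val : (Ω \ {x} : Set X) → X))) := by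
    rw [hιr, Set.insert_sdiff_singleton, Set.insert_eq_of_mem hxΩ]
    exact hΩ.1.isClosed
  obtain ⟨c⟩ := hμ.exists_prod_self
  obtain ⟨r, hr⟩ := hμ.exists_prod_self_of_infinite hS hS'
  have hr0 : (Set.range fun z => (r (0, z) : X)) = ⋃ k ∈ S, Y k := by
    have : (Set.range fun z => (r (0, z) : X)) = Subtype.val '' (μ ⁻¹' S) := by
      rw [← hr, ← Set.range_comp]
      rfl
    rw [this]
    ext y
    simp only [Set.mem_iUnion]
    constructor
    · rintro ⟨z, hz, rfl⟩
      exact ⟨μ z, hz, (hμY z _).2 rfl⟩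
    · rintro ⟨k, hk, hy⟩
      have hy' : y ∈ Ω \ {x} := by
        rw [hY.union]
        exact Set.mem_iUnion.2 ⟨k, hy⟩
      refine ⟨⟨y, hy'⟩, ?_, rfl⟩
      rwa [Set.mem_preimage, (hμY ⟨y, hy'⟩ k).1 hy]
  rw [← hr0] at hB
  obtain ⟨h0, hh0⟩ := exists_restrict (e := fun z => (r (0, z) : X))
    (hι.comp ((IsClopenEmb.homeo r).comp (IsClopenEmb.slice 0)).isOpenEmbedding).isEmbedding
    h hB.mem_iff
  have hp : IsClopenEmb fun q : ℕ × (Ω \ {x} : Set X) => r (2 * q.1, q.2) :=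
    (IsClopenEmb.homeo r).comp (IsClopenEmb.reindex (j := fun k => 2 * k) fun a b h => by
      simpa using h)
  have hl : IsClopenEmb fun z => r (1, z) := (IsClopenEmb.homeo r).comp (IsClopenEmb.slice 1)
  have hpl : ∀ (q : ℕ × (Ω \ {x} : Set X)) z, r (2 * q.1, q.2) ≠ r (1, z) := fun q z h => by
    have := congrArg Prod.fst (r.injective h)
    simp only at this
    omega
  have h1 := one_mem_mul_self hsym hcov
  have hpow : W ^ 6 = (W * W) * (W * W) * (W * W) := by
    simp only [pow_succ, pow_zero, one_mul, mul_assoc]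
  obtain ⟨Q, hQ, ρ, hρ, hρQ⟩ : ∃ Q, IsGood W Q ∧ ∃ ρ ∈ W ^ 6,
      ∀ q : ℕ × (Ω \ {x} : Set X), ρ (r (2 * q.1, q.2) : X) ∈ Q := by
    rw [hpow]
    by_cases hemb : ∃ e : Ω → X, IsOpenEmbedding e ∧ ∀ y, e y ∈ Ω \ {x}
    · obtain ⟨e, he, hex⟩ := hemb
      obtain ⟨Q, hQ, ρ, hρ, hρQ⟩ := exists_isGood_move_of_embedding hsym hcov hΩ.1 hdense hι hιr
        hc c hl hpl he hex
      refine ⟨Q, hQ, ρ, ?_, hρQ⟩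
      have := Set.mul_mem_mul (Set.mul_mem_mul hρ h1) h1
      rwa [mul_one, mul_one] at this
    · refine exists_isGood_move_of_fixed hsym hcov hΩ.1 hdense hι hιr hc hμ c hl hpl
        fun w hw => ?_
      by_contra hwx
      obtain ⟨U, hU, hxU, hUs⟩ := compact_exists_isClopen_in_isOpen
        (hΩ.1.isOpen.inter ((isOpen_compl_singleton (x := x)).preimage w.continuous))
        (⟨hxΩ, hwx⟩ : x ∈ Ω ∩ w ⁻¹' {x}ᶜ)
      obtain ⟨Φ, -⟩ := hΩ.2.2 U (fun y hy => (hUs hy).1) hU (hU.isOpen.mem_nhds hxU)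
      refine hemb ⟨fun y => w (Φ y), w.isOpenEmbedding.comp
        (hU.isOpen.isOpenEmbedding_subtypeVal.comp Φ.isOpenEmbedding), fun y => ?_⟩
      exact ⟨(hw _).1 (hUs (Φ y).2).1, (hUs (Φ y).2).2⟩
  exact mem_pow_of_isGood hsym hcov x (hι.comp hp.isOpenEmbedding)
    (isClosed_insert_range_comp hι hc hp) (h0 := h0) (fun z => (hh0 z).symm) hB hQ hρ hρQ
end

section
/- Let X be a second countable Stone space, x ∈ X, and Ω a stable clopen neighborhood of x. Suppose W ⊆ Homeo(X) is symmetric, Homeo(X) is covered by countably many left translates of W, and G(Ω) is contained in the closure of W·W. Then G(Ω) ⊆ W⁹⁶. -/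
open Pointwise Topology

namespace StableSteinhaus

open Set Filter

variable {X : Type*} [TopologicalSpace X]

@[simp] lemma mul_apply (f g : X ≃ₜ X) (y : X) : (f * g) y = f (g y) := rfl

@[simp] lemma one_apply (y : X) : (1 : X ≃ₜ X) y = y := rfl

@[simp] lemma inv_apply_self (f : X ≃ₜ X) (y : X) : f⁻¹ (f y) = y := f.symm_apply_apply y

@[simp] lemma apply_inv_self (f : X ≃ₜ X) (y : X) : f (f⁻¹ y) = y := f.apply_symm_apply y

lemma suppOn_inv {f : X ≃ₜ X} {A : Set X} (hf : f ∈ suppIn A) : f⁻¹ ∈ suppIn A := by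
  intro y hy
  conv_lhs => rw [← hf y hy]
  simp

lemma suppOn_mul {f g : X ≃ₜ X} {A : Set X} (hf : f ∈ suppIn A) (hg : g ∈ suppIn A) :
    f * g ∈ suppIn A := by
  intro y hy
  rw [mul_apply, hg y hy, hf y hy]

lemma one_mem_suppIn (A : Set X) : (1 : X ≃ₜ X) ∈ suppIn A := fun _ _ => rfl

lemma suppIn_mono {A B : Set X} (h : A ⊆ B) : suppIn A ⊆ suppIn B :=
  fun _ hf y hy => hf y fun hA => hy (h hA)

lemma apply_mem_of_suppOn {f : X ≃ₜ X} {A : Set X} (hf : f ∈ suppIn A) {y : X} (hy : y ∈ A) :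
    f y ∈ A := by
  by_contra h
  exact h (by rwa [f.injective (hf _ h)])

lemma conj_mem_suppIn {f u : X ≃ₜ X} {A B : Set X} (hf : f ∈ suppIn A)
    (hu : ∀ y ∈ A, u y ∈ B) : u * f * u⁻¹ ∈ suppIn B := by
  intro y hy
  have h : u⁻¹ y ∉ A := fun h => hy (by simpa using hu _ h)
  rw [mul_apply, mul_apply, hf _ h, apply_inv_self]

lemma commute_of_disjoint {f g : X ≃ₜ X} {A B : Set X} (hf : f ∈ suppIn A)
    (hg : g ∈ suppIn B) (h : Disjoint A B) : Commute f g := by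
  refine Homeomorph.ext fun y => ?_
  rw [mul_apply, mul_apply]
  by_cases hA : y ∈ A
  · rw [hg y (disjoint_left.1 h hA), hg _ (disjoint_left.1 h (apply_mem_of_suppOn hf hA))]
  · rw [hf y hA]
    by_cases hB : y ∈ B
    · exact hf _ (disjoint_right.1 h (apply_mem_of_suppOn hg hB))
    · rw [hg y hB, hf y hA]

/-- A product of homeomorphisms with disjoint supports accumulating only at `x`. -/
lemma exists_continuous_glue [T2Space X] {ι : Type*} {x : X} {T : ι → Set X}
    (hT : Pairwise fun i j => Disjoint (T i) (T j)) (hx : ∀ i, x ∉ T i)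
    (hfin : ∀ U ∈ nhds x, {i | ¬ T i ⊆ U}.Finite) {f : ι → X ≃ₜ X}
    (hf : ∀ i, f i ∈ suppIn (T i)) :
    ∃ F : X → X, Continuous F ∧ (∀ i, ∀ y ∈ T i, F y = f i y) ∧
      ∀ y, (∀ i, y ∉ T i) → F y = y := by
  classical
  have huniq : ∀ {i j y}, y ∈ T i → y ∈ T j → i = j := fun {i j y} hi hj => by
    by_contra h
    exact disjoint_left.1 (hT h) hi hj
  obtain ⟨F, hF, hF'⟩ : ∃ F : X → X, (∀ i, ∀ y ∈ T i, F y = f i y) ∧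
      ∀ y, (∀ i, y ∉ T i) → F y = y := by
    refine ⟨fun y => if h : ∃ i, y ∈ T i then f h.choose y else y, fun i y hy => ?_,
      fun y hy => ?_⟩
    · have h : ∃ i, y ∈ T i := ⟨i, hy⟩
      simp only [dif_pos h]
      rw [huniq h.choose_spec hy]
    · simp [hy]
  have hpart : ∀ s : Finset ι, ∃ p : X ≃ₜ X, (∀ i ∈ s, ∀ y ∈ T i, p y = f i y) ∧
      ∀ y, (∀ i ∈ s, y ∉ T i) → p y = y := by
    intro s
    induction s using Finset.induction_on with
    | empty => exact ⟨1, by simp, by simp⟩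
    | insert a s ha ih =>
      obtain ⟨p, hp, hp'⟩ := ih
      refine ⟨p * f a, fun i hi y hy => ?_, fun y hy => ?_⟩
      · rw [mul_apply]
        by_cases hia : i = a
        · subst hia
          refine hp' _ fun j hj hy' => ha ?_
          rwa [huniq (apply_mem_of_suppOn (hf i) hy) hy']
        · rw [hf a y fun h => hia (huniq hy h), hp i ((Finset.mem_insert.1 hi).resolve_left hia) y hy]
      · rw [mul_apply, hf a y (hy a (Finset.mem_insert_self a s)),
          hp' y fun i hi => hy i (Finset.mem_insert_of_mem hi)]
  refine ⟨F, continuous_iff_continuousAt.2 fun y => ?_, hF, hF'⟩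
  by_cases hyx : y = x
  · subst hyx
    rw [ContinuousAt, hF' y hx]
    intro U hU
    obtain ⟨p, hp, hp'⟩ := hpart (hfin U hU).toFinset
    have hpy : p y = y := hp' y fun i _ => hx i
    have h1 : ∀ᶠ z in nhds y, p z ∈ U :=
      p.continuous.continuousAt (x := y) (by rwa [hpy])
    change ∀ᶠ z in nhds y, F z ∈ U
    filter_upwards [h1, hU] with z hz hzU
    by_cases h : ∃ i, z ∈ T i
    · obtain ⟨i, hi⟩ := h
      rw [hF i z hi]
      by_cases his : T i ⊆ U
      · exact his (apply_mem_of_suppOn (hf i) hi)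
      · rwa [← hp i (by simpa using his) z hi]
    · push Not at h
      rwa [hF' z h]
  · obtain ⟨U, U', hU, hU', hxU, hyU, hd⟩ := t2_separation (Ne.symm hyx)
    obtain ⟨p, hp, hp'⟩ := hpart (hfin U (hU.mem_nhds hxU)).toFinset
    refine (p.continuous.continuousAt (x := y)).congr ?_
    filter_upwards [hU'.mem_nhds hyU] with z hz
    by_cases h : ∃ i, z ∈ T i
    · obtain ⟨i, hi⟩ := h
      rw [hF i z hi]
      exact hp i (by simpa using fun h => disjoint_left.1 hd (h hi) hz) z hi
    · push Not at h
      rw [hF' z h, hp' z fun i _ => h i]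

lemma exists_glue [T2Space X] {ι : Type*} {x : X} {T : ι → Set X}
    (hT : Pairwise fun i j => Disjoint (T i) (T j)) (hx : ∀ i, x ∉ T i)
    (hfin : ∀ U ∈ nhds x, {i | ¬ T i ⊆ U}.Finite) {f : ι → X ≃ₜ X}
    (hf : ∀ i, f i ∈ suppIn (T i)) :
    ∃ F ∈ suppIn (⋃ i, T i), ∀ i, ∀ y ∈ T i, F y = f i y := by
  obtain ⟨F, hFc, hF, hF'⟩ := exists_continuous_glue hT hx hfin hf
  obtain ⟨E, hEc, hE, hE'⟩ :=
    exists_continuous_glue hT hx hfin (f := fun i => (f i)⁻¹) fun i => suppOn_inv (hf i)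
  have key : ∀ {F E : X → X} {f e : ι → X ≃ₜ X}, (∀ i, f i ∈ suppIn (T i)) →
      (∀ i, ∀ y, e i (f i y) = y) →
      (∀ i, ∀ y ∈ T i, F y = f i y) → (∀ y, (∀ i, y ∉ T i) → F y = y) →
      (∀ i, ∀ y ∈ T i, E y = e i y) → (∀ y, (∀ i, y ∉ T i) → E y = y) →
      Function.LeftInverse E F := by
    intro F E f e hf hef hF hF' hE hE' y
    by_cases h : ∃ i, y ∈ T i
    · obtain ⟨i, hi⟩ := h
      rw [hF i y hi, hE i _ (apply_mem_of_suppOn (hf i) hi), hef]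
    · push Not at h
      rw [hF' y h, hE' y h]
  refine ⟨⟨⟨F, E, key hf (by simp) hF hF' hE hE',
    key (fun i => suppOn_inv (hf i)) (by simp) hE hE' hF hF'⟩, hFc, hEc⟩, ?_, hF⟩
  intro y hy
  exact hF' y (by simpa using hy)

/-- The involution exchanging a clopen set with a disjoint copy of it. -/
lemma exists_swap_of_continuousOn [CompactSpace X] [T2Space X] {P : Set X} (hP : IsClopen P)
    {f : X → X} (hf : ContinuousOn f P) (hinj : InjOn f P) (hQ : IsOpen (f '' P))
    (hd : Disjoint P (f '' P)) :
    ∃ s ∈ suppIn (P ∪ f '' P), (∀ y ∈ P, s y = f y) ∧ ∀ y ∈ P, s (f y) = y := by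
  classical
  have hPc : IsCompact P := hP.isClosed.isCompact
  have hQc : IsClosed (f '' P) := (hPc.image_of_continuousOn hf).isClosed
  have : CompactSpace P := isCompact_iff_compactSpace.1 hPc
  set e : P ≃ f '' P := Equiv.Set.imageOfInjOn f P hinj with he
  have hec : Continuous e := by
    refine Continuous.subtype_mk (f := fun y : P => f y) ?_ _
    exact continuousOn_iff_continuous_domRestrict.1 hf
  have hes : Continuous e.symm := (Continuous.homeoOfEquivCompactToT2 hec).symm.continuous
  obtain ⟨g, hg⟩ : ∃ g : X → X, ∀ y (h : y ∈ f '' P), g y = e.symm ⟨y, h⟩ :=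
    ⟨fun y => if h : y ∈ f '' P then e.symm ⟨y, h⟩ else y, fun y h => dif_pos h⟩
  have hgf : ∀ y ∈ P, g (f y) = y := by
    intro y hy
    rw [hg _ (mem_image_of_mem f hy)]
    have : e ⟨y, hy⟩ = ⟨f y, mem_image_of_mem f hy⟩ := rfl
    rw [← this, e.symm_apply_apply]
  have hgc : ContinuousOn g (f '' P) := by
    rw [continuousOn_iff_continuous_domRestrict]
    have : (f '' P).domRestrict g = fun y => (e.symm y : X) := funext fun y => hg y y.2
    rw [this]
    exact continuous_subtype_val.comp hes
  set s : X → X := fun y => if y ∈ P then f y else if y ∈ f '' P then g y else y with hs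
  have s1 : ∀ y ∈ P, s y = f y := fun y hy => if_pos hy
  have s2 : ∀ y ∈ f '' P, s y = g y := fun y hy => by
    simp only [hs, if_neg (disjoint_right.1 hd hy), if_pos hy]
  have s3 : ∀ y, y ∉ P ∪ f '' P → s y = y := fun y hy => by
    rw [mem_union, not_or] at hy
    simp only [hs, if_neg hy.1, if_neg hy.2]
  have s2' : ∀ y ∈ P, s (f y) = y := fun y hy => by
    rw [s2 _ (mem_image_of_mem f hy), hgf y hy]
  have hsc : Continuous s := by
    refine continuous_iff_continuousAt.2 fun y => ?_
    by_cases h1 : y ∈ P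
    · exact (hf.continuousAt (hP.isOpen.mem_nhds h1)).congr
        (by filter_upwards [hP.isOpen.mem_nhds h1] with z hz using (s1 z hz).symm)
    by_cases h2 : y ∈ f '' P
    · exact (hgc.continuousAt (hQ.mem_nhds h2)).congr
        (by filter_upwards [hQ.mem_nhds h2] with z hz using (s2 z hz).symm)
    · have h : (P ∪ f '' P)ᶜ ∈ nhds y :=
        (hP.isClosed.union hQc).isOpen_compl.mem_nhds (by simp only [mem_compl_iff, mem_union]; tauto)
      exact continuousAt_id.congr (by filter_upwards [h] with z hz using (s3 z hz).symm)
  have hss : Function.Involutive s := by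
    intro y
    by_cases h1 : y ∈ P
    · rw [s1 y h1, s2' y h1]
    by_cases h2 : y ∈ f '' P
    · obtain ⟨z, hz, rfl⟩ := h2
      rw [s2' z hz, s1 z hz]
    · have h : y ∉ P ∪ f '' P := by simp only [mem_union]; tauto
      rw [s3 y h, s3 y h]
  exact ⟨⟨⟨s, s, hss, hss⟩, hsc, hsc⟩, s3, s1, s2'⟩

lemma exists_swap [CompactSpace X] [T2Space X] {P : Set X} (hP : IsClopen P) (q : X ≃ₜ X)
    (hd : ∀ y ∈ P, q y ∉ P) :
    ∃ s ∈ suppIn (P ∪ q '' P), (∀ y ∈ P, s y = q y) ∧ ∀ y ∈ P, s (q y) = y := by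
  refine exists_swap_of_continuousOn hP q.continuous.continuousOn q.injective.injOn
    (q.isOpenMap _ hP.isOpen) (disjoint_left.2 ?_)
  rintro _ hy ⟨z, hz, rfl⟩
  exact hd z hz hy

/-- A nested clopen neighborhood basis `V` of `x`, starting at `Ω`, such that `Ω \ V j` is copied
into the ring `V j \ V (j + 1)` by a homeomorphism `σ j` supported on `Ω`. -/
structure IsTower (x : X) (Ω : Set X) (V : ℕ → Set X) (σ : ℕ → X ≃ₜ X) : Prop where
  zero : V 0 = Ω
  anti : Antitone V
  clopen : ∀ n, IsClopen (V n)
  mem : ∀ n, x ∈ V n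
  basis : ∀ U ∈ nhds x, ∃ n, V n ⊆ U
  supp : ∀ n, σ n ∈ suppIn Ω
  map : ∀ n, ∀ y ∈ Ω, y ∉ V n → σ n y ∈ V n \ V (n + 1)

lemma exists_tower_step [CompactSpace X] [T2Space X] [TotallyDisconnectedSpace X] {x : X}
    {Ω : Set X} (hΩ : IsStableNbhd x Ω) {V U : Set X} (hV : IsClopen V) (hxV : x ∈ V)
    (hVΩ : V ⊆ Ω) (hU : U ∈ nhds x) :
    ∃ V' : Set X, ∃ σ ∈ suppIn Ω, IsClopen V' ∧ x ∈ V' ∧ V' ⊆ V ∧ V' ⊆ U ∧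
      ∀ y ∈ Ω, y ∉ V → σ y ∈ V \ V' := by
  classical
  obtain ⟨hΩc, hxΩ, hst⟩ := hΩ
  obtain ⟨Φ, hΦ⟩ := hst V hVΩ hV (hV.isOpen.mem_nhds hxV)
  obtain ⟨f, hf⟩ : ∃ f : X → X, ∀ y (h : y ∈ Ω), f y = Φ ⟨y, h⟩ :=
    ⟨fun y => if h : y ∈ Ω then Φ ⟨y, h⟩ else y, fun y h => dif_pos h⟩
  have hfV : ∀ y ∈ Ω, f y ∈ V := fun y hy => by rw [hf y hy]; exact (Φ _).2
  have hfc : ContinuousOn f Ω := by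
    rw [continuousOn_iff_continuous_domRestrict]
    have : Ω.domRestrict f = fun y => (Φ y : X) := funext fun y => hf y y.2
    rw [this]
    exact continuous_subtype_val.comp Φ.continuous
  have hfi : InjOn f Ω := fun y hy z hz h => by
    rw [hf y hy, hf z hz] at h
    exact congrArg Subtype.val (Φ.injective (Subtype.ext h))
  have hK : IsClopen (Ω \ V) := hΩc.diff hV
  have hKΩ : Ω \ V ⊆ Ω := sdiff_subset
  have himg : f '' (Ω \ V) = Subtype.val '' (Φ '' (Subtype.val ⁻¹' (Ω \ V))) := by
    ext y
    constructor
    · rintro ⟨z, hz, rfl⟩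
      exact ⟨_, ⟨⟨z, hz.1⟩, hz, rfl⟩, (hf z hz.1).symm⟩
    · rintro ⟨_, ⟨z, hz, rfl⟩, rfl⟩
      exact ⟨z, hz, hf z z.2⟩
  have hopen : IsOpen (f '' (Ω \ V)) := by
    rw [himg]
    exact hV.isOpen.isOpenMap_subtype_val _
      (Φ.isOpenMap _ (hK.isOpen.preimage continuous_subtype_val))
  have hclosed : IsClosed (f '' (Ω \ V)) :=
    (hK.isClosed.isCompact.image_of_continuousOn (hfc.mono hKΩ)).isClosed
  have hsub : f '' (Ω \ V) ⊆ V := by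
    rintro _ ⟨z, hz, rfl⟩
    exact hfV z hz.1
  obtain ⟨σ, hσ, hσf, -⟩ := exists_swap_of_continuousOn hK (hfc.mono hKΩ) (hfi.mono hKΩ) hopen
    (disjoint_left.2 fun y hy hy' => hy.2 (hsub hy'))
  have hx : x ∉ f '' (Ω \ V) := by
    rintro ⟨z, hz, hzx⟩
    have hxO := hVΩ hxV
    have : z = x := hfi hz.1 hxO (by rw [hzx, hf x hxO, hΦ hxO])
    exact hz.2 (this ▸ hxV)
  have hN : V ∩ U ∩ (f '' (Ω \ V))ᶜ ∈ nhds x :=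
    inter_mem (inter_mem (hV.isOpen.mem_nhds hxV) hU) (hclosed.isOpen_compl.mem_nhds hx)
  obtain ⟨V', ⟨hx', hV'⟩, hs⟩ := (nhds_basis_clopen x).mem_iff.1 hN
  refine ⟨V', σ, suppIn_mono (union_subset hKΩ (hsub.trans hVΩ)) hσ, hV', hx',
    fun y hy => (hs hy).1.1, fun y hy => (hs hy).1.2, fun y hy hyV => ?_⟩
  rw [hσf y ⟨hy, hyV⟩]
  exact ⟨hfV y hy, fun h => (hs h).2 ⟨y, ⟨hy, hyV⟩, rfl⟩⟩

lemma exists_tower [CompactSpace X] [T2Space X] [FirstCountableTopology X]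
    [TotallyDisconnectedSpace X] {x : X} {Ω : Set X} (hΩ : IsStableNbhd x Ω) :
    ∃ V σ, IsTower x Ω V σ := by
  obtain ⟨U, hU⟩ := (nhds x).exists_antitone_basis
  have hxΩ : x ∈ Ω := mem_of_mem_nhds hΩ.2.1
  choose! next σ hσ hc hx hsub hsubU hmap using
    fun (n : ℕ) (V : Set X) (h : IsClopen V ∧ x ∈ V ∧ V ⊆ Ω) =>
      exists_tower_step hΩ h.1 h.2.1 h.2.2 (hU.mem n)
  set V : ℕ → Set X := fun n => Nat.rec Ω next n with hVdef
  have hsucc : ∀ n, V (n + 1) = next n (V n) := fun n => rfl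
  have hV : ∀ n, IsClopen (V n) ∧ x ∈ V n ∧ V n ⊆ Ω := by
    intro n
    induction n with
    | zero => exact ⟨hΩ.1, hxΩ, subset_rfl⟩
    | succ n ih =>
      rw [hsucc]
      exact ⟨hc n _ ih, hx n _ ih, (hsub n _ ih).trans ih.2.2⟩
  refine ⟨V, fun n => σ n (V n), rfl, antitone_nat_of_succ_le fun n => hsub n _ (hV n),
    fun n => (hV n).1, fun n => (hV n).2.1, fun S hS => ?_, fun n => hσ n _ (hV n),
    fun n y hy hyV => hmap n _ (hV n) y hy hyV⟩
  obtain ⟨n, hn⟩ := hU.mem_iff.1 hS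
  exact ⟨n + 1, (hsubU n _ (hV n)).trans hn⟩

lemma exists_swaps [CompactSpace X] [T2Space X] {ι : Type*} {x : X} {P : ι → Set X}
    {q : ι → X ≃ₜ X} (hP : ∀ i, IsClopen (P i)) (hq : ∀ i, ∀ y ∈ P i, q i y ∉ P i)
    (hT : Pairwise fun i j => Disjoint (P i ∪ q i '' P i) (P j ∪ q j '' P j))
    (hx : ∀ i, x ∉ P i ∪ q i '' P i)
    (hfin : ∀ U ∈ nhds x, {i | ¬ P i ∪ q i '' P i ⊆ U}.Finite) :
    ∃ F ∈ suppIn (⋃ i, P i ∪ q i '' P i), (∀ i, ∀ y ∈ P i, F y = q i y) ∧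
      ∀ i, ∀ y ∈ P i, F (q i y) = y := by
  choose s hs hs1 hs2 using fun i => exists_swap (hP i) (q i) (hq i)
  obtain ⟨F, hF, hF'⟩ := exists_glue hT hx hfin hs
  refine ⟨F, hF, fun i y hy => ?_, fun i y hy => ?_⟩
  · rw [hF' i y (Or.inl hy), hs1 i y hy]
  · rw [hF' i _ (Or.inr ⟨y, hy, rfl⟩), hs2 i y hy]

/-- The union of the rings of `V` with index in `S`. -/
def pieces {X : Type*} (V : ℕ → Set X) (S : Set ℕ) : Set X := {y | ∃ k ∈ S, y ∈ V k \ V (k + 1)}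

lemma pieces_mono {X : Type*} (V : ℕ → Set X) {S T : Set ℕ} (h : S ⊆ T) : pieces V S ⊆ pieces V T :=
  fun _ ⟨k, hk, hy⟩ => ⟨k, h hk, hy⟩

namespace IsTower

variable {x : X} {Ω : Set X} {V : ℕ → Set X} {σ : ℕ → X ≃ₜ X}

lemma subset (h : IsTower x Ω V σ) (n : ℕ) : V n ⊆ Ω := h.zero ▸ h.anti (Nat.zero_le n)

lemma not_mem_of_ring (h : IsTower x Ω V σ) {k n : ℕ} (hkn : k < n) {y : X}
    (hy : y ∈ V k \ V (k + 1)) : y ∉ V n := fun hn => hy.2 (h.anti hkn hn)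

lemma ring_unique (h : IsTower x Ω V σ) {k l : ℕ} {y : X} (hk : y ∈ V k \ V (k + 1))
    (hl : y ∈ V l \ V (l + 1)) : k = l := by
  rcases lt_trichotomy k l with hkl | hkl | hkl
  · exact absurd hl.1 (h.not_mem_of_ring hkl hk)
  · exact hkl
  · exact absurd hk.1 (h.not_mem_of_ring hkl hl)

lemma exists_ring_lt (h : IsTower x Ω V σ) {n : ℕ} {y : X} (hy : y ∈ Ω) (hn : y ∉ V n) :
    ∃ k < n, y ∈ V k \ V (k + 1) := by
  induction n with
  | zero => exact absurd (h.zero ▸ hy) hn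
  | succ n ih =>
    by_cases hyn : y ∈ V n
    · exact ⟨n, n.lt_succ_self, hyn, hn⟩
    · obtain ⟨k, hk, hyk⟩ := ih hyn
      exact ⟨k, hk.trans n.lt_succ_self, hyk⟩

lemma exists_not_mem [T1Space X] (h : IsTower x Ω V σ) {y : X} (hy : y ≠ x) :
    ∃ n, y ∉ V n := by
  obtain ⟨n, hn⟩ := h.basis {y}ᶜ (isOpen_compl_singleton.mem_nhds hy.symm)
  exact ⟨n, fun h => hn h rfl⟩

lemma exists_ring [T1Space X] (h : IsTower x Ω V σ) {y : X} (hy : y ∈ Ω) (hyx : y ≠ x) :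
    ∃ k, y ∈ V k \ V (k + 1) := by
  obtain ⟨n, hn⟩ := h.exists_not_mem hyx
  obtain ⟨k, -, hk⟩ := h.exists_ring_lt hy hn
  exact ⟨k, hk⟩

lemma not_mem_pieces (h : IsTower x Ω V σ) (S : Set ℕ) : x ∉ pieces V S :=
  fun ⟨k, _, hk⟩ => hk.2 (h.mem (k + 1))

lemma pieces_subset (h : IsTower x Ω V σ) (S : Set ℕ) : pieces V S ⊆ Ω :=
  fun _ ⟨k, _, hk⟩ => h.subset k hk.1

lemma disjoint_pieces (h : IsTower x Ω V σ) {S T : Set ℕ} (hST : Disjoint S T) :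
    Disjoint (pieces V S) (pieces V T) :=
  disjoint_left.2 fun _ ⟨_, hk, hyk⟩ ⟨_, hl, hyl⟩ =>
    disjoint_left.1 hST hk (h.ring_unique hyk hyl ▸ hl)

lemma isClopen_ring (h : IsTower x Ω V σ) (k : ℕ) : IsClopen (V k \ V (k + 1)) :=
  (h.clopen k).diff (h.clopen (k + 1))

lemma map_ring (h : IsTower x Ω V σ) {k j : ℕ} (hkj : k < j) {y : X}
    (hy : y ∈ V k \ V (k + 1)) : σ j y ∈ V j \ V (j + 1) :=
  h.map j y (h.subset k hy.1) (h.not_mem_of_ring hkj hy)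

lemma finite_not_subset (h : IsTower x Ω V σ) {ι : Type*} {T : ι → Set X} {φ : ι → ℕ}
    (hφ : Function.Injective φ) (hT : ∀ i, T i ⊆ V (φ i)) :
    ∀ U ∈ nhds x, {i | ¬ T i ⊆ U}.Finite := by
  intro U hU
  obtain ⟨n, hn⟩ := h.basis U hU
  refine ((finite_lt_nat n).preimage hφ.injOn).subset fun i hi => ?_
  by_contra hc
  exact hi ((hT i).trans ((h.anti (not_lt.1 hc)).trans hn))

end IsTower

lemma inv_mul_mem {W : Set (X ≃ₜ X)} (hsym : W = W⁻¹) {g f f' : X ≃ₜ X} (hf : f ∈ g • W)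
    (hf' : f' ∈ g • W) : f⁻¹ * f' ∈ W * W := by
  obtain ⟨w, hw, rfl⟩ := hf
  obtain ⟨w', hw', rfl⟩ := hf'
  refine ⟨w⁻¹, ?_, w', hw', ?_⟩
  · rw [hsym]
    exact Set.inv_mem_inv.2 hw
  · simp only [smul_eq_mul]
    group

/-- An injective coding of pairs `(k, A ∩ {0, …, k - 1})`. -/
lemma exists_prefix_code : ∃ c : Set ℕ → ℕ → ℕ, (∀ A k, k < c A k) ∧
    ∀ A B k l, c A k = c B l → k = l ∧ ∀ i < k, i ∈ A ↔ i ∈ B := by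
  classical
  refine ⟨fun A k => Nat.pair (k + 1)
    (Encodable.encode ((List.range k).map fun i => decide (i ∈ A))),
    fun A k => Nat.lt_of_succ_le (Nat.left_le_pair _ _), fun A B k l hc => ?_⟩
  obtain ⟨h1, h2⟩ := Nat.pair_eq_pair.1 hc
  obtain rfl : k = l := by omega
  refine ⟨rfl, fun i hi => ?_⟩
  have := List.map_inj_left.1 (Encodable.encode_injective h2) i (List.mem_range.2 hi)
  simpa using this

variable {x : X} {Ω : Set X} {V : ℕ → Set X} {σ : ℕ → X ≃ₜ X} {W : Set (X ≃ₜ X)}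

/-- Some element of `W * W` pushes all but finitely many rings indexed by `S` into the rings
indexed by `T`. -/
lemma exists_push [CompactSpace X] [T2Space X] (h : IsTower x Ω V σ) (hsym : W = W⁻¹)
    (hcov : ∃ g : ℕ → X ≃ₜ X, (⋃ i, g i • W) = Set.univ) {S T : Set ℕ} (hST : Disjoint S T)
    (hT : T.Infinite) :
    ∃ n, ∃ r ∈ W * W, r ∈ suppIn (pieces V (S ∪ T)) ∧
      ∀ k ∈ S, n ≤ k → ∀ y ∈ V k \ V (k + 1), r y ∈ pieces V T := by
  obtain ⟨g, hg⟩ := hcov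
  obtain ⟨c, hc, hc'⟩ := exists_prefix_code
  set e : ℕ → ℕ := Nat.nth (· ∈ T)
  have he : StrictMono e := Nat.nth_strictMono hT
  have heT : ∀ n, e n ∈ T := fun n => Nat.nth_mem_of_infinite hT n
  have hlt : ∀ A k, k < e (c A k) := fun A k => (hc A k).trans_le he.le_apply
  have hsupp : ∀ A, ∀ k ∈ S,
      (V k \ V (k + 1)) ∪ σ (e (c A k)) '' (V k \ V (k + 1)) ⊆ pieces V {k, e (c A k)} := by
    rintro A k hk y (hy | ⟨z, hz, rfl⟩)
    · exact ⟨k, by simp, hy⟩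
    · exact ⟨e (c A k), by simp, h.map_ring (hlt A k) hz⟩
  have key : ∀ A : Set ℕ, ∃ v ∈ suppIn (⋃ k : S, pieces V {(k : ℕ), e (c A k)}),
      ∀ k ∈ S, ∀ y ∈ V k \ V (k + 1), v y ∈ V (e (c A k)) \ V (e (c A k) + 1) := by
    intro A
    have hdisj : Pairwise fun k l : S =>
        Disjoint ((V k \ V (k + 1)) ∪ σ (e (c A k)) '' (V k \ V (k + 1)))
          ((V l \ V (l + 1)) ∪ σ (e (c A l)) '' (V l \ V (l + 1))) := by
      intro k l hkl
      refine (h.disjoint_pieces ?_).mono (hsupp A k k.2) (hsupp A l l.2)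
      have hne : (k : ℕ) ≠ l := fun hkl' => hkl (Subtype.ext hkl')
      refine disjoint_left.2 fun m hm hm' => ?_
      simp only [mem_insert_iff, mem_singleton_iff] at hm hm'
      rcases hm with rfl | rfl <;> rcases hm' with hm' | hm'
      · exact hne hm'
      · exact disjoint_left.1 hST k.2 (hm' ▸ heT _)
      · exact disjoint_left.1 hST l.2 (hm' ▸ heT _)
      · exact hne (hc' _ _ _ _ (he.injective hm')).1
    have hsub : ∀ k : S, (V k \ V (k + 1)) ∪ σ (e (c A k)) '' (V k \ V (k + 1)) ⊆ V k := by
      intro k y hy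
      obtain ⟨m, hm, hy⟩ := hsupp A k k.2 hy
      rcases hm with rfl | rfl
      · exact hy.1
      · exact h.anti (hlt A k).le hy.1
    obtain ⟨F, hF, hF1, -⟩ := exists_swaps (x := x) (P := fun k : S => V k \ V (k + 1))
      (q := fun k : S => σ (e (c A k))) (fun k => h.isClopen_ring k)
      (fun k y hy hy' => (hlt A k).ne (h.ring_unique hy' (h.map_ring (hlt A k) hy)))
      hdisj (fun k hx => h.not_mem_pieces _ (hsupp A k k.2 hx))
      (h.finite_not_subset Subtype.val_injective hsub)
    refine ⟨F, suppIn_mono (iUnion_mono fun k : S => hsupp A k k.2) hF, fun k hk y hy => ?_⟩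
    rw [hF1 ⟨k, hk⟩ y hy]
    exact h.map_ring (hlt A k) hy
  choose v hv hvm using key
  have hidx : ∀ A, ∃ i, v A ∈ g i • W := fun A => by
    have : v A ∈ ⋃ i, g i • W := hg ▸ mem_univ _
    simpa using this
  choose idx hidx using hidx
  obtain ⟨A, B, hAB, hne⟩ : ∃ A B, idx A = idx B ∧ A ≠ B := by
    have := Function.cantor_injective idx
    simpa [Function.Injective] using this
  obtain ⟨m, hm⟩ : ∃ m, ¬ (m ∈ A ↔ m ∈ B) := by
    by_contra hcon
    push Not at hcon
    exact hne (Set.ext hcon)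
  have hvST : ∀ A, v A ∈ suppIn (pieces V (S ∪ T)) := fun A =>
    suppIn_mono (iUnion_subset fun k => pieces_mono V (by
      rintro j (hj | hj)
      · exact Or.inl (hj ▸ k.2)
      · exact Or.inr (hj ▸ heT _))) (hv A)
  refine ⟨m + 1, (v A)⁻¹ * v B, inv_mul_mem hsym (hAB ▸ hidx A) (hidx B),
    suppOn_mul (suppOn_inv (hvST A)) (hvST B), fun k hk hmk y hy => ?_⟩
  have hy' := hvm B k hk y hy
  rw [mul_apply, suppOn_inv (hv A)]
  · exact ⟨_, heT _, hy'⟩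
  · simp only [mem_iUnion, not_exists]
    rintro l ⟨j, hj, hyj⟩
    obtain rfl := h.ring_unique hyj hy'
    rcases hj with hj | hj
    · exact disjoint_left.1 hST l.2 (hj ▸ heT _)
    · obtain ⟨rfl, hi⟩ := hc' _ _ _ _ (he.injective hj)
      exact hm (hi m (by omega)).symm

lemma mul_mem_pow {m n : ℕ} {f g : X ≃ₜ X} (hf : f ∈ W ^ m) (hg : g ∈ W ^ n) :
    f * g ∈ W ^ (m + n) := by
  rw [pow_add]
  exact Set.mul_mem_mul hf hg

lemma inv_mem_pow (hsym : W = W⁻¹) {n : ℕ} {f : X ≃ₜ X} (hf : f ∈ W ^ n) : f⁻¹ ∈ W ^ n := by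
  rw [hsym, inv_pow]
  exact Set.inv_mem_inv.2 hf

lemma mem_pow_of_conj (hsym : W = W⁻¹) {n : ℕ} {u f : X ≃ₜ X} (hu : u ∈ W ^ 2)
    (hf : u * f * u⁻¹ ∈ W ^ n) : f ∈ W ^ (n + 4) := by
  have := mul_mem_pow (mul_mem_pow (inv_mem_pow hsym hu) hf) hu
  rw [show 2 + n + 2 = n + 4 by omega] at this
  convert this using 1
  group

/-- If countably many sets cover a product, then one of them, after fixing finitely many
coordinates, projects onto the next factor. -/
lemma exists_prefix_surjective {H : ℕ → Type*} [∀ i, Nonempty (H i)]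
    {E : ℕ → Set (∀ j, H j)} (hE : ∀ q, ∃ i, q ∈ E i) :
    ∃ i, ∃ p : ∀ j, H j, ∀ a : H i, ∃ q ∈ E i, (∀ j < i, q j = p j) ∧ q i = a := by
  by_contra! hcon
  choose c hc using hcon
  let Q : ℕ → ∀ j, H j := fun n =>
    Nat.rec (fun j => Classical.arbitrary (H j)) (fun n p => Function.update p n (c n p)) n
  have hQ : ∀ n, ∀ j < n, Q n j = c j (Q j) := by
    intro n
    induction n with
    | zero => intro j hj; omega
    | succ n ih =>
      intro j hj
      change Function.update (Q n) n (c n (Q n)) j = _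
      rcases Nat.lt_succ_iff_lt_or_eq.1 hj with hj | rfl
      · rw [Function.update_of_ne hj.ne, ih j hj]
      · rw [Function.update_self]
  obtain ⟨i, hi⟩ := hE fun n => c n (Q n)
  exact hc i (Q i) _ hi (fun j hj => (hQ i j hj).symm) rfl

lemma commutator_eq {G : Type*} [Group G] {a b f g : G} (hfb : Commute f b) (hfg : Commute f g)
    (hga : Commute g a) :
    a * b * a⁻¹ * b⁻¹ = a * f * (b * g) * (a * f)⁻¹ * (b * g)⁻¹ := by
  have h1 : f * (b * g) = b * g * f := (hfb.mul_right hfg).eq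
  have h2 : g * a⁻¹ = a⁻¹ * g := hga.inv_right.eq
  calc a * b * a⁻¹ * b⁻¹ = a * b * (a⁻¹ * g) * g⁻¹ * b⁻¹ := by group
    _ = a * (b * g * f) * f⁻¹ * a⁻¹ * g⁻¹ * b⁻¹ := by rw [← h2]; group
    _ = _ := by rw [← h1]; group

lemma exists_commutator_mem [CompactSpace X] [T2Space X] (h : IsTower x Ω V σ) (hsym : W = W⁻¹)
    (hcov : ∃ g : ℕ → X ≃ₜ X, (⋃ i, g i • W) = Set.univ) :
    ∃ S : Set ℕ, S.Infinite ∧ ∀ a ∈ suppIn (pieces V S), ∀ b ∈ suppIn (pieces V S),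
      a * b * a⁻¹ * b⁻¹ ∈ W ^ 16 := by
  have hinf : ∀ j N, {k | (Nat.unpair k).1 = j ∧ N ≤ k}.Infinite := fun j N =>
    Set.infinite_of_injective_forall_mem (f := fun m => Nat.pair j (N + m))
      (fun m m' hm => by
        have := (Nat.pair_eq_pair.1 hm).2
        omega)
      fun m => ⟨by simp, (Nat.le_add_right N m).trans (Nat.right_le_pair _ _)⟩
  set D : Set ℕ := {k | (Nat.unpair k).1 = 0} with hD
  have hDinf : D.Infinite := (hinf 0 0).mono fun k hk => hk.1
  choose n r hrW hrs hrm using fun i : ℕ => exists_push h hsym hcov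
    (S := {k | i + 1 < (Nat.unpair k).1}) (T := D)
    (disjoint_left.2 fun k hk hk' => by
      simp only [hD, mem_ofPred_eq] at hk hk'
      omega) hDinf
  obtain ⟨N, hN⟩ : ∃ N : ℕ → ℕ, ∀ j, ∀ i ≤ j, n i ≤ N j :=
    ⟨fun j => (Finset.range (j + 1)).sup n, fun j i hi =>
      Finset.le_sup (f := n) (Finset.mem_range.2 (Nat.lt_succ_of_le hi))⟩
  set I : ℕ → Set ℕ := fun j => {k | (Nat.unpair k).1 = j + 1 ∧ N j ≤ k} with hI
  have hId : Pairwise fun j l => Disjoint (pieces V (I j)) (pieces V (I l)) := fun j l hjl =>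
    h.disjoint_pieces (disjoint_left.2 fun k hk hk' => hjl (by
      have := hk.1
      have := hk'.1
      omega))
  have hIV : ∀ j, pieces V (I j) ⊆ V j := by
    rintro j y ⟨k, hk, hy⟩
    have h1 := hk.1
    have h2 := Nat.unpair_left_le k
    exact h.anti (by omega) hy.1
  choose F hFs hF using fun q : ∀ j, suppIn (pieces V (I j)) =>
    exists_glue hId (fun j => h.not_mem_pieces _)
      (h.finite_not_subset Function.injective_id hIV) (fun j => (q j).2)
  obtain ⟨g, hg⟩ := hcov
  have : ∀ j, Nonempty (suppIn (pieces V (I j))) := fun j => ⟨⟨1, one_mem_suppIn _⟩⟩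
  obtain ⟨i, p, hp⟩ := exists_prefix_surjective (E := fun i => {q | F q ∈ g i • W}) fun q => by
    have : F q ∈ ⋃ i, g i • W := hg ▸ mem_univ _
    simpa using this
  set B : Set X := pieces V (I i) with hB
  set C : Set X := ⋃ j ∈ Ioi i, pieces V (I j) with hC
  have hBC : Disjoint B C := by
    simp only [hC, disjoint_iUnion_right]
    exact fun j hj => hId (ne_of_lt hj)
  have hBD : Disjoint B (pieces V D) := h.disjoint_pieces (disjoint_left.2 fun k hk hk' => by
    have h1 := hk.1
    simp only [hD, mem_ofPred_eq] at hk'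
    omega)
  have hCD : Disjoint C (pieces V D) := by
    simp only [hC, disjoint_iUnion_left]
    exact fun j hj => h.disjoint_pieces (disjoint_left.2 fun k hk hk' => by
      have h1 := hk.1
      simp only [hD, mem_ofPred_eq] at hk'
      omega)
  have hmatch : ∀ a ∈ suppIn B, ∃ f ∈ suppIn C, a * f ∈ W * W := by
    intro a ha
    obtain ⟨q₀, hq₀, hq₀p, hq₀i⟩ := hp ⟨1, one_mem_suppIn _⟩
    obtain ⟨q, hq, hqp, hqi⟩ := hp ⟨a, ha⟩
    refine ⟨a⁻¹ * ((F q₀)⁻¹ * F q), ?_, ?_⟩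
    · intro y hy
      simp only [mul_apply]
      by_cases hyB : y ∈ B
      · have h1 : F q y = a y := by rw [hF q i y hyB, hqi]
        have h2 : F q₀ (a y) = a y := by
          rw [hF q₀ i _ (apply_mem_of_suppOn ha hyB), hq₀i]
          rfl
        rw [h1]
        conv_lhs => rw [← h2]
        simp only [inv_apply_self]
      · have h1 : F q y = F q₀ y := by
          by_cases hj : ∃ j, y ∈ pieces V (I j)
          · obtain ⟨j, hj⟩ := hj
            have hji : j < i := by
              rcases lt_trichotomy j i with hji | rfl | hji
              · exact hji
              · exact absurd hj hyB
              · exact absurd (mem_biUnion hji hj) hy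
            rw [hF q j y hj, hF q₀ j y hj, hqp j hji, hq₀p j hji]
          · rw [hFs q y (by simpa using hj), hFs q₀ y (by simpa using hj)]
        rw [h1, inv_apply_self, suppOn_inv ha y hyB]
    · rw [mul_inv_cancel_left]
      exact inv_mul_mem hsym hq₀ hq
  have hrC : ∀ y ∈ C, r i y ∈ pieces V D := by
    intro y hy
    simp only [hC, mem_iUnion] at hy
    obtain ⟨j, hj, k, hk, hy⟩ := hy
    have h1 : i < j := hj
    exact hrm i k (by have := hk.1; simp only [mem_ofPred_eq]; omega)
      ((hN j i h1.le).trans hk.2) y hy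
  have hrB : Disjoint B (pieces V ({k | i + 1 < (Nat.unpair k).1} ∪ D)) :=
    h.disjoint_pieces (disjoint_left.2 fun k hk hk' => by
      have h1 := hk.1
      simp only [hD, mem_union, mem_ofPred_eq] at hk'
      omega)
  refine ⟨I i, hinf _ _, fun a ha b hb => ?_⟩
  obtain ⟨f, hf, hfW⟩ := hmatch a ha
  obtain ⟨g', hg', hgW⟩ := hmatch b hb
  rw [← pow_two] at hfW hgW
  have hr2 : r i ∈ W ^ 2 := by
    rw [pow_two]
    exact hrW i
  have hgs : r i * g' * (r i)⁻¹ ∈ suppIn (pieces V D) := conj_mem_suppIn hg' hrC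
  have hbr : b * (r i * g' * (r i)⁻¹) = r i * (b * g') * (r i)⁻¹ := by
    rw [← mul_assoc, ← mul_assoc, (commute_of_disjoint hb (hrs i) hrB).eq]
    group
  have hbW : b * (r i * g' * (r i)⁻¹) ∈ W ^ 6 := by
    rw [hbr]
    exact mul_mem_pow (mul_mem_pow hr2 hgW) (inv_mem_pow hsym hr2)
  rw [commutator_eq (commute_of_disjoint hb hf hBC).symm (commute_of_disjoint hf hgs hCD)
    (commute_of_disjoint ha hgs hBD).symm]
  exact mul_mem_pow (mul_mem_pow (mul_mem_pow hfW hbW) (inv_mem_pow hsym hfW))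
    (inv_mem_pow hsym hbW)

/-- A homeomorphism whose nonnegative iterates displace the brick `S'` disjointly towards `x`. -/
lemma exists_shift [CompactSpace X] [T2Space X] (h : IsTower x Ω V σ) {S : Set ℕ}
    (hS : S.Infinite) :
    ∃ S' : Set ℕ, S'.Infinite ∧ ∃ b ∈ suppIn (pieces V S),
      (Pairwise fun i j => Disjoint (⇑(b ^ i) '' pieces V S') (⇑(b ^ j) '' pieces V S')) ∧
      ∀ i, ⇑(b ^ i) '' pieces V S' ⊆ V i ∩ pieces V S := by
  classical
  set e : ℕ → ℕ := Nat.nth (· ∈ S)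
  have he : StrictMono e := Nat.nth_strictMono hS
  have heS : ∀ n, e n ∈ S := fun n => Nat.nth_mem_of_infinite hS n
  set τ : ℕ → ℕ → ℕ := fun p m => e (Nat.pair p m) with hτ
  have hτinj : ∀ {p m p' m'}, τ p m = τ p' m' → p = p' ∧ m = m' := fun hh =>
    Nat.pair_eq_pair.1 (he.injective hh)
  have hτlt : ∀ {p p'} m, p < p' → τ p m < τ p' m := fun m hp =>
    he (Nat.pair_lt_pair_left m hp)
  have hτle : ∀ p m, p ≤ τ p m := fun p m => (Nat.left_le_pair p m).trans he.le_apply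
  set R : ℕ → Set X := fun m => V (τ 0 m) \ V (τ 0 m + 1) with hR
  set θ : ℕ → ℕ → X ≃ₜ X := fun p m => if p = 0 then 1 else σ (τ p m) with hθ
  have hθ0 : ∀ m, θ 0 m = 1 := fun m => if_pos rfl
  have hθR : ∀ p m, ∀ z ∈ R m, θ p m z ∈ V (τ p m) \ V (τ p m + 1) := by
    intro p m z hz
    rcases Nat.eq_zero_or_pos p with rfl | hp
    · rw [hθ0]
      exact hz
    · simp only [hθ, if_neg hp.ne']
      exact h.map_ring (hτlt m hp) hz
  have hρ : ∀ ε, ∃ ρ ∈ suppIn (pieces V S), ∀ i m, ∀ z ∈ R m,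
      ρ (θ (2 * i + ε) m z) = θ (2 * i + ε + 1) m z := by
    intro ε
    set P : ℕ × ℕ → Set X := fun t => θ (2 * t.1 + ε) t.2 '' R t.2 with hP
    set q : ℕ × ℕ → X ≃ₜ X := fun t => θ (2 * t.1 + ε + 1) t.2 * (θ (2 * t.1 + ε) t.2)⁻¹ with hq
    have hqP : ∀ t, ∀ z ∈ R t.2, q t (θ (2 * t.1 + ε) t.2 z) = θ (2 * t.1 + ε + 1) t.2 z :=
      fun t z _ => by simp only [hq, mul_apply, inv_apply_self]
    have hsub : ∀ t, P t ∪ q t '' P t ⊆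
        pieces V {τ (2 * t.1 + ε) t.2, τ (2 * t.1 + ε + 1) t.2} := by
      rintro t y (⟨z, hz, rfl⟩ | ⟨_, ⟨z, hz, rfl⟩, rfl⟩)
      · exact ⟨_, by simp, hθR _ _ z hz⟩
      · rw [hqP t z hz]
        exact ⟨_, by simp, hθR _ _ z hz⟩
    obtain ⟨ρ, hρ, hρ', -⟩ := exists_swaps (x := x) (P := P) (q := q)
      (fun t => ⟨(θ (2 * t.1 + ε) t.2).isClosedMap _ (h.isClopen_ring _).isClosed,
        (θ (2 * t.1 + ε) t.2).isOpenMap _ (h.isClopen_ring _).isOpen⟩)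
      (by
        rintro t _ ⟨z, hz, rfl⟩ ⟨z', hz', hzz⟩
        rw [hqP t z hz] at hzz
        have := hτinj (h.ring_unique (hθR _ _ z' hz') (hzz ▸ hθR _ _ z hz))
        omega)
      (fun t t' ht => (h.disjoint_pieces (disjoint_left.2 fun k hk hk' => by
        have hne : ¬ (t.1 = t'.1 ∧ t.2 = t'.2) := fun hh => ht (Prod.ext hh.1 hh.2)
        simp only [mem_insert_iff, mem_singleton_iff] at hk hk'
        rcases hk with rfl | rfl <;> rcases hk' with hk' | hk' <;>
          have := hτinj hk' <;> omega)).mono (hsub t) (hsub t'))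
      (fun t ht => h.not_mem_pieces _ (hsub t ht))
      (h.finite_not_subset (φ := fun t => τ (2 * t.1 + ε) t.2)
        (fun t t' ht => Prod.ext (by have := hτinj ht; omega) (hτinj ht).2) (fun t y hy => by
          obtain ⟨k, hk, hy⟩ := hsub t hy
          rcases hk with rfl | rfl
          · exact hy.1
          · exact h.anti (hτlt _ (Nat.lt_succ_self _)).le hy.1))
    refine ⟨ρ, suppIn_mono (iUnion_subset fun t => (hsub t).trans (pieces_mono V ?_)) hρ,
      fun i m z hz => ?_⟩
    · rintro k (rfl | rfl) <;> exact heS _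
    · rw [hρ' (i, m) _ ⟨z, hz, rfl⟩, hqP (i, m) z hz]
  obtain ⟨ρ₀, hρ₀, hρ₀'⟩ := hρ 0
  obtain ⟨ρ₁, hρ₁, hρ₁'⟩ := hρ 1
  have hpow : ∀ i m, ∀ z ∈ R m, ((ρ₁ * ρ₀) ^ i) z = θ (2 * i) m z := by
    intro i m z hz
    induction i with
    | zero => rw [pow_zero, mul_zero, hθ0]
    | succ i ih =>
      rw [pow_succ', mul_apply, ih, mul_apply]
      have := hρ₀' i m z hz
      rw [add_zero] at this
      rw [this, hρ₁' i m z hz]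
      rfl
  have hmem : ∀ i, ⇑((ρ₁ * ρ₀) ^ i) '' pieces V (range (τ 0)) ⊆ pieces V (range (τ (2 * i))) := by
    rintro i _ ⟨z, ⟨_, ⟨m, rfl⟩, hz⟩, rfl⟩
    rw [hpow i m z hz]
    exact ⟨_, ⟨m, rfl⟩, hθR _ _ z hz⟩
  refine ⟨range (τ 0), ?_, ρ₁ * ρ₀, suppOn_mul hρ₁ hρ₀, fun i j hij => ?_, fun i => ?_⟩
  · exact infinite_range_of_injective fun m m' hm => (hτinj hm).2
  · refine (h.disjoint_pieces (disjoint_left.2 ?_)).mono (hmem i) (hmem j)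
    rintro _ ⟨m, rfl⟩ ⟨m', hm⟩
    have := hτinj hm
    omega
  · refine (hmem i).trans (subset_inter ?_ (pieces_mono V ?_))
    · rintro y ⟨_, ⟨m, rfl⟩, hy⟩
      have := hτle (2 * i) m
      exact h.anti (by omega) hy.1
    · rintro _ ⟨m, rfl⟩
      exact heS _

lemma exists_brick_commutators [CompactSpace X] [T2Space X] (h : IsTower x Ω V σ) {S : Set ℕ}
    (hS : S.Infinite) :
    ∃ S' : Set ℕ, S'.Infinite ∧ ∀ f ∈ suppIn (pieces V S'),
      ∃ a ∈ suppIn (pieces V S), ∃ b ∈ suppIn (pieces V S), f = a * b * a⁻¹ * b⁻¹ := by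
  obtain ⟨S', hinf, b, hb, hd, hsub⟩ := exists_shift h hS
  refine ⟨S', hinf, fun f hf => ?_⟩
  have hsucc : ∀ i, ∀ y, b y ∈ ⇑(b ^ (i + 1)) '' pieces V S' ↔ y ∈ ⇑(b ^ i) '' pieces V S' := by
    intro i y
    rw [pow_succ']
    constructor
    · rintro ⟨z, hz, hzy⟩
      exact ⟨z, hz, b.injective hzy⟩
    · rintro ⟨z, hz, rfl⟩
      exact ⟨z, hz, rfl⟩
  have hzero : ⇑(b ^ 0) '' pieces V S' = pieces V S' := by
    rw [pow_zero]
    exact image_id _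
  have hfi : ∀ i : ℕ, b ^ i * f * (b ^ i)⁻¹ ∈ suppIn (⇑(b ^ i) '' pieces V S') := fun i =>
    conj_mem_suppIn hf fun y hy => mem_image_of_mem _ hy
  obtain ⟨a, ha, ha'⟩ := exists_glue hd
    (fun i hx => h.not_mem_pieces S (hsub i hx).2)
    (h.finite_not_subset Function.injective_id fun i => (hsub i).trans inter_subset_left) hfi
  refine ⟨a, suppIn_mono (iUnion_subset fun i => (hsub i).trans inter_subset_right) ha, b, hb, ?_⟩
  suffices hab : f * b * a = a * b by rw [← hab]; group
  refine Homeomorph.ext fun y => ?_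
  simp only [mul_apply]
  by_cases hy : ∃ i, y ∈ ⇑(b ^ i) '' pieces V S'
  · obtain ⟨i, hi⟩ := hy
    have h1 : b (a y) ∈ ⇑(b ^ (i + 1)) '' pieces V S' := by
      rw [hsucc, ha' i y hi]
      exact apply_mem_of_suppOn (hfi i) hi
    rw [hf _ fun h0 => disjoint_left.1 (hd i.succ_ne_zero) h1 (hzero.symm ▸ h0),
      ha' (i + 1) _ ((hsucc i y).2 hi), ha' i y hi, ← mul_apply b, ← mul_apply _ b]
    congr 1
    rw [pow_succ']
    group
  · have hay : a y = y := ha y (by simpa using hy)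
    push Not at hy
    rw [hay]
    by_cases h0 : b y ∈ pieces V S'
    · rw [ha' 0 _ (hzero.symm ▸ h0)]
      rfl
    · rw [hf _ h0]
      refine (ha _ ?_).symm
      simp only [mem_iUnion, not_exists]
      rintro (_ | i) hi
      · exact h0 (hzero ▸ hi)
      · exact hy i ((hsucc i y).1 hi)

lemma exists_brick_subset_pow [CompactSpace X] [T2Space X] (h : IsTower x Ω V σ)
    (hsym : W = W⁻¹) (hcov : ∃ g : ℕ → X ≃ₜ X, (⋃ i, g i • W) = Set.univ) :
    ∃ S : Set ℕ, S.Infinite ∧ suppIn (pieces V S) ⊆ W ^ 16 := by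
  obtain ⟨S, hS, hcomm⟩ := exists_commutator_mem h hsym hcov
  obtain ⟨S', hS', hf⟩ := exists_brick_commutators h hS
  refine ⟨S', hS', fun f hfs => ?_⟩
  obtain ⟨a, ha, b, hb, rfl⟩ := hf f hfs
  exact hcomm a ha b hb

lemma exists_mapsTo_of_mem_closure {f : X ≃ₜ X} (hf : f ∈ closure (W * W)) {K U : Set X}
    (hK : IsCompact K) (hU : IsOpen U) (hfK : MapsTo f K U) : ∃ u ∈ W ^ 2, MapsTo u K U := by
  have hopen : IsOpen {u : X ≃ₜ X | MapsTo u K U} :=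
    isOpen_induced (f := fun u : X ≃ₜ X => (u : C(X, X)))
      (ContinuousMap.isOpen_setOfPred_mapsTo hK hU)
  obtain ⟨u, hu, huW⟩ := mem_closure_iff.1 hf _ hopen hfK
  exact ⟨u, pow_two W ▸ huW, hu⟩

lemma suppIn_diff_subset_pow [CompactSpace X] (h : IsTower x Ω V σ) (hsym : W = W⁻¹)
    (hdense : suppIn Ω ⊆ closure (W * W)) {S : Set ℕ} (hS : S.Infinite)
    (hSW : suppIn (pieces V S) ⊆ W ^ 16) (n : ℕ) : suppIn (Ω \ V n) ⊆ W ^ 20 := by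
  intro f hf
  obtain ⟨j, hj, hnj⟩ := hS.exists_gt n
  have hΩ : IsClopen Ω := h.zero ▸ h.clopen 0
  obtain ⟨u, hu, hmap⟩ := exists_mapsTo_of_mem_closure (hdense (h.supp j))
    ((hΩ.diff (h.clopen n)).isClosed.isCompact) (h.isClopen_ring j).isOpen
    fun y hy => h.map j y hy.1 fun hyj => hy.2 (h.anti hnj.le hyj)
  exact mem_pow_of_conj hsym hu (hSW (conj_mem_suppIn hf fun y hy => ⟨j, hj, hmap hy⟩))

lemma mem_pow_of_map_ne [CompactSpace X] [T2Space X] (h : IsTower x Ω V σ) (hsym : W = W⁻¹)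
    (hdense : suppIn Ω ⊆ closure (W * W)) (hW : ∀ n, suppIn (Ω \ V n) ⊆ W ^ 20) {g : X ≃ₜ X}
    (hg : g ∈ suppIn Ω) (hgx : g x ≠ x) : g ∈ W ^ 44 := by
  have hΩ : IsClopen Ω := h.zero ▸ h.clopen 0
  have hxΩ : x ∈ Ω := h.zero ▸ h.mem 0
  have hgΩ : g x ∈ Ω := apply_mem_of_suppOn hg hxΩ
  obtain ⟨n, hn⟩ := h.exists_not_mem hgx
  set z := σ n (g x) with hz
  have hzV : z ∈ V n \ V (n + 1) := h.map n _ hgΩ hn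
  have hzx : x ≠ z := fun hh => hzV.2 (hh ▸ h.mem _)
  have hgz : x ≠ g⁻¹ z := fun hh => hn (by
    rw [hh, apply_inv_self]
    exact hzV.1)
  obtain ⟨U, U', hU, hU', hxU, hgU, hUU⟩ := t2_separation hgx.symm
  obtain ⟨m, hm⟩ := h.basis (({z}ᶜ ∩ {g⁻¹ z}ᶜ) ∩ (U ∩ g ⁻¹' U')) (inter_mem
    (inter_mem (isOpen_compl_singleton.mem_nhds hzx) (isOpen_compl_singleton.mem_nhds hgz))
    (inter_mem (hU.mem_nhds hxU) ((hU'.preimage g.continuous).mem_nhds hgU)))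
  obtain ⟨s, hs, -, hs'⟩ := exists_swap (h.clopen m) g fun y hy hgy =>
    disjoint_left.1 hUU (hm hgy).2.1 (hm hy).2.2
  have hQΩ : V m ∪ g '' V m ⊆ Ω := by
    refine union_subset (h.subset m) ?_
    rintro _ ⟨y, hy, rfl⟩
    exact apply_mem_of_suppOn hg (h.subset m hy)
  have hQ : IsCompact (V m ∪ g '' V m) :=
    (h.clopen m).isClosed.isCompact.union ((h.clopen m).isClosed.isCompact.image g.continuous)
  have hf : (σ n * g)⁻¹ ∈ suppIn Ω := suppOn_inv (suppOn_mul (h.supp n) hg)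
  have hxQ : x ∉ ⇑(σ n * g)⁻¹ '' (V m ∪ g '' V m) := by
    rintro ⟨y, hy, hyx⟩
    have hyz : y = z := by
      rw [hz, ← mul_apply, ← hyx, apply_inv_self]
    rcases hy with hy | ⟨v, hv, hvy⟩
    · exact (hm hy).1.1 hyz
    · refine (hm hv).1.2 ?_
      rw [mem_singleton_iff, ← hyz, ← hvy, inv_apply_self]
  obtain ⟨l, hl⟩ := h.basis _ ((hQ.image (σ n * g)⁻¹.continuous).isClosed.isOpen_compl.mem_nhds hxQ)
  obtain ⟨u, hu, hmap⟩ := exists_mapsTo_of_mem_closure (hdense hf) hQ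
    (hΩ.diff (h.clopen l)).isOpen fun y hy =>
      ⟨apply_mem_of_suppOn hf (hQΩ hy), fun hyl => hl hyl ⟨y, hy, rfl⟩⟩
  have hsW : s ∈ W ^ 24 := mem_pow_of_conj hsym hu (hW l (conj_mem_suppIn hs hmap))
  have hsg : s * g ∈ W ^ 20 := hW m fun y hy => by
    rw [mul_apply]
    by_cases hyΩ : y ∈ Ω
    · exact hs' y (by_contra fun hym => hy ⟨hyΩ, hym⟩)
    · rw [hg y hyΩ, hs y fun hyQ => hyΩ (hQΩ hyQ)]
  have := mul_mem_pow (inv_mem_pow hsym hsW) hsg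
  rwa [inv_mul_cancel_left] at this

/-- A homeomorphism fixing `x` moves each ring `c m` inside a block of its own. -/
lemma exists_spread [CompactSpace X] [T2Space X] (h : IsTower x Ω V σ) {S : Set ℕ}
    (hS : S.Infinite) {g : X ≃ₜ X} (hgx : g x = x) :
    ∃ c : ℕ → ℕ, StrictMono c ∧ (∀ m, c m ∈ S) ∧
      (∀ m l, ∀ y ∈ V (c m) \ V (c m + 1), g y ∈ V (c l) \ V (c l + 1) → l = m) ∧
      ∀ n m, n < m → ∀ y ∈ V (c m), g y ∈ V n := by
  have hstep : ∀ k, ∃ k' ∈ S, k < k' ∧ (∀ y ∈ V k', g y ∈ V (k + 1)) ∧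
      ∀ y, y ∉ V (k + 1) → g y ∉ V k' := by
    intro k
    have hgx' : g⁻¹ x = x := by
      conv_lhs => rw [← hgx]
      simp only [inv_apply_self]
    have hV : V (k + 1) ∈ nhds x := (h.clopen _).isOpen.mem_nhds (h.mem _)
    obtain ⟨n₁, h₁⟩ := h.basis (g ⁻¹' V (k + 1)) (g.continuous.continuousAt (by rwa [hgx]))
    obtain ⟨n₂, h₂⟩ := h.basis (⇑(g⁻¹ : X ≃ₜ X) ⁻¹' V (k + 1)) (g⁻¹.continuous.continuousAt (by rwa [hgx']))
    obtain ⟨k', hk', hlt⟩ := hS.exists_gt (max k (max n₁ n₂))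
    simp only [max_lt_iff] at hlt
    refine ⟨k', hk', hlt.1, fun y hy => h₁ (h.anti hlt.2.1.le hy), fun y hy hgy => hy ?_⟩
    have : g⁻¹ (g y) ∈ V (k + 1) := h₂ (h.anti hlt.2.2.le hgy)
    rwa [inv_apply_self] at this
  choose next hnS hnlt hn1 hn2 using hstep
  obtain ⟨k₀, hk₀⟩ := hS.nonempty
  let c : ℕ → ℕ := fun m => Nat.rec k₀ (fun _ k => next k) m
  have hsucc : ∀ m, c (m + 1) = next (c m) := fun m => rfl
  have hc : StrictMono c := strictMono_nat_of_lt_succ fun m => hnlt (c m)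
  refine ⟨c, hc, fun m => ?_, fun m l y hy hgy => ?_, fun n m hnm y hy => ?_⟩
  · cases m with
    | zero => exact hk₀
    | succ m => exact hnS _
  · rcases lt_trichotomy l m with hlm | hlm | hlm
    · exact absurd (hn1 (c l) y (h.anti (hc.monotone (Nat.succ_le_of_lt hlm)) hy.1)) hgy.2
    · exact hlm
    · exact absurd (h.anti (hc.monotone (Nat.succ_le_of_lt hlm)) hgy.1) (hn2 (c m) y hy.2)
  · have := hn1 (c n) y (h.anti (hc.monotone (Nat.succ_le_of_lt hnm)) hy)
    exact h.anti ((hc.le_apply (x := n)).trans (Nat.le_succ _)) this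

/-- A homeomorphism fixing `x` agrees on some brick with an element of `W ^ 36`. -/
lemma exists_eqOn_brick [CompactSpace X] [T2Space X] (h : IsTower x Ω V σ) (hsym : W = W⁻¹)
    (hcov : ∃ g : ℕ → X ≃ₜ X, (⋃ i, g i • W) = Set.univ) {S : Set ℕ} (hS : S.Infinite)
    (hSW : suppIn (pieces V S) ⊆ W ^ 16) {g : X ≃ₜ X} (hg : g ∈ suppIn Ω) (hgx : g x = x) :
    ∃ I ⊆ S, I.Infinite ∧ (S \ I).Infinite ∧
      ∃ s ∈ W ^ 36, s ∈ suppIn Ω ∧ s x = x ∧ ∀ y ∈ pieces V I, s y = g y := by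
  obtain ⟨c, hc, hcS, hcg, hcV⟩ := exists_spread h hS hgx
  obtain ⟨n, r, hr, hrs, hrm⟩ := exists_push h hsym hcov (S := Sᶜ)
    (T := range fun l => c (3 * l + 2))
    (disjoint_left.2 (by rintro _ hk ⟨l, rfl⟩; exact hk (hcS _)))
    (infinite_range_of_injective fun l l' hl => by have := hc.injective hl; omega)
  set L : ℕ → ℕ := fun l => 3 * (l + n + 1) with hL
  set P : ℕ → Set X := fun l => V (c (L l)) \ V (c (L l) + 1) with hP
  have hσP : ∀ l, ∀ y ∈ P l, σ (c (L l + 1)) y ∈ V (c (L l + 1)) \ V (c (L l + 1) + 1) :=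
    fun l y hy => h.map_ring (hc (Nat.lt_succ_self _)) hy
  have hsub₁ : ∀ l, P l ∪ σ (c (L l + 1)) '' P l ⊆ pieces V {c (L l), c (L l + 1)} := by
    rintro l y (hy | ⟨z, hz, rfl⟩)
    · exact ⟨_, by simp, hy⟩
    · exact ⟨_, by simp, hσP l z hz⟩
  obtain ⟨s₁, hs₁, hs₁P, -⟩ := exists_swaps (x := x) (P := P) (q := fun l => σ (c (L l + 1)))
    (fun l => h.isClopen_ring _)
    (fun l y hy hy' => by
      have := hc.injective (h.ring_unique hy' (hσP l y hy))
      omega)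
    (fun l l' hl => (h.disjoint_pieces (disjoint_left.2 fun k hk hk' => by
      simp only [mem_insert_iff, mem_singleton_iff] at hk hk'
      rcases hk with rfl | rfl <;> rcases hk' with hk' | hk' <;>
        have := hc.injective hk' <;> simp only [hL] at this <;> omega)).mono (hsub₁ l) (hsub₁ l'))
    (fun l hl => h.not_mem_pieces _ (hsub₁ l hl))
    (h.finite_not_subset (φ := fun l => c (L l))
      (fun l l' hl => by
        have := hc.injective hl
        simp only [hL] at this
        omega)
      (fun l y hy => by
        obtain ⟨k, hk, hy⟩ := hsub₁ l hy
        rcases hk with rfl | rfl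
        · exact hy.1
        · exact h.anti (hc (Nat.lt_succ_self _)).le hy.1))
  have hs₁S : s₁ ∈ suppIn (pieces V S) := suppIn_mono (iUnion_subset fun l =>
    (hsub₁ l).trans (pieces_mono V (by rintro k (rfl | rfl) <;> exact hcS _))) hs₁
  have hs₁R : ∀ l, ∀ y ∈ P l, s₁ y ∈ V (c (L l + 1)) \ V (c (L l + 1) + 1) := fun l y hy => by
    rw [hs₁P l y hy]
    exact hσP l y hy
  have hq : ∀ y, (g * s₁⁻¹) (s₁ y) = g y := fun y => by rw [mul_apply, inv_apply_self]
  have hcase : ∀ l, ∀ y ∈ s₁ '' P l ∪ ⇑(g * s₁⁻¹) '' (s₁ '' P l),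
      y ∈ V (c (L l + 1)) \ V (c (L l + 1) + 1) ∨ ∃ z ∈ P l, g z = y := by
    rintro l y (⟨z, hz, rfl⟩ | ⟨_, ⟨z, hz, rfl⟩, rfl⟩)
    · exact Or.inl (hs₁R l z hz)
    · exact Or.inr ⟨z, hz, (hq z).symm⟩
  obtain ⟨s₂, hs₂, hs₂P, -⟩ := exists_swaps (x := x) (P := fun l => s₁ '' P l)
    (q := fun _ => g * s₁⁻¹)
    (fun l => ⟨s₁.isClosedMap _ (h.isClopen_ring _).isClosed,
      s₁.isOpenMap _ (h.isClopen_ring _).isOpen⟩)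
    (by
      rintro l _ ⟨z, hz, rfl⟩ ⟨z', hz', hzz⟩
      rw [hq] at hzz
      have := hcg _ _ z hz (hzz ▸ hs₁R l z' hz')
      omega)
    (fun l l' hl => disjoint_left.2 fun y hy hy' => by
      rcases hcase l y hy with hy | ⟨z, hz, rfl⟩ <;> rcases hcase l' _ hy' with hy' | ⟨z', hz', hzz⟩
      · have := hc.injective (h.ring_unique hy hy')
        simp only [hL] at this
        omega
      · have := hcg _ _ z' hz' (hzz.symm ▸ hy)
        simp only [hL] at this
        omega
      · have := hcg _ _ z hz hy'
        simp only [hL] at this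
        omega
      · rw [g.injective hzz] at hz'
        have := hc.injective (h.ring_unique hz hz')
        simp only [hL] at this
        omega)
    (fun l hl => by
      rcases hcase l x hl with hx | ⟨z, hz, hzx⟩
      · exact hx.2 (h.mem _)
      · exact hz.2 (g.injective (hzx.trans hgx.symm) ▸ h.mem _))
    (h.finite_not_subset Function.injective_id fun l y hy => by
      rcases hcase l y hy with hy | ⟨z, hz, rfl⟩
      · have := hc.le_apply (x := L l + 1)
        exact h.anti (by simp only [hL, id] at this ⊢; omega) hy.1
      · exact hcV _ _ (by simp only [hL, id]; omega) z hz.1)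
  have hr₂ : r ∈ W ^ 2 := pow_two W ▸ hr
  have hrS : ∀ y ∈ ⋃ l, s₁ '' P l ∪ ⇑(g * s₁⁻¹) '' (s₁ '' P l), r y ∈ pieces V S := by
    intro y hy
    obtain ⟨l, hy⟩ := mem_iUnion.1 hy
    have hfix : ∀ k ∈ S, (∀ i, k ≠ c (3 * i + 2)) → y ∈ V k \ V (k + 1) → r y ∈ pieces V S := by
      intro k hk hki hyk
      rw [hrs y]
      · exact ⟨k, hk, hyk⟩
      · rintro ⟨j, hj, hyj⟩
        obtain rfl := h.ring_unique hyk hyj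
        rcases hj with hj | ⟨i, hi⟩
        · exact hj hk
        · exact hki i hi.symm
    rcases hcase l y hy with hyl | ⟨z, hz, rfl⟩
    · refine hfix _ (hcS _) (fun i hi => ?_) hyl
      have := hc.injective hi
      simp only [hL] at this
      omega
    · have hzx : g z ≠ x := fun hzx => hz.2 (g.injective (hzx.trans hgx.symm) ▸ h.mem _)
      obtain ⟨k, hk⟩ := h.exists_ring (apply_mem_of_suppOn hg (h.subset _ hz.1)) hzx
      by_cases hkS : k ∈ S
      · refine hfix k hkS (fun i hi => ?_) hk
        have := hcg _ _ z hz (hi ▸ hk)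
        simp only [hL] at this
        omega
      · refine pieces_mono V ?_ (hrm k hkS ?_ _ hk)
        · rintro _ ⟨i, rfl⟩
          exact hcS _
        · by_contra hkn
          exact h.not_mem_of_ring (not_le.1 hkn) hk
            (hcV n (L l) (by simp only [hL]; omega) z hz.1)
  have hs₂W : s₂ ∈ W ^ 20 := mem_pow_of_conj hsym hr₂ (hSW (conj_mem_suppIn hs₂ hrS))
  have hs₂Ω : s₂ ∈ suppIn Ω := by
    refine suppIn_mono (iUnion_subset fun l y hy => ?_) hs₂
    rcases hcase l y hy with hy | ⟨z, hz, rfl⟩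
    · exact h.subset _ hy.1
    · exact apply_mem_of_suppOn hg (h.subset _ hz.1)
  have hs₁x : s₁ x = x := hs₁S x (h.not_mem_pieces S)
  have hs₂x : s₂ x = x := hs₂ x fun hx => by
    obtain ⟨l, hl⟩ := mem_iUnion.1 hx
    rcases hcase l x hl with hx | ⟨z, hz, hzx⟩
    · exact hx.2 (h.mem _)
    · exact hz.2 (g.injective (hzx.trans hgx.symm) ▸ h.mem _)
  refine ⟨range fun l => c (L l), ?_, ?_, ?_, s₂ * s₁,
    mul_mem_pow hs₂W (hSW hs₁S), suppOn_mul hs₂Ω (suppIn_mono (h.pieces_subset S) hs₁S), ?_, ?_⟩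
  · rintro _ ⟨l, rfl⟩
    exact hcS _
  · refine infinite_range_of_injective fun l l' hl => ?_
    have := hc.injective hl
    simp only [hL] at this
    omega
  · refine (infinite_range_of_injective (f := fun l => c (3 * l + 1)) fun l l' hl => ?_).mono ?_
    · have := hc.injective hl
      omega
    · rintro _ ⟨l, rfl⟩
      refine ⟨hcS _, ?_⟩
      rintro ⟨l', hl⟩
      have := hc.injective hl
      simp only [hL] at this
      omega
  · rw [mul_apply, hs₁x, hs₂x]
  · rintro y ⟨_, ⟨l, rfl⟩, hy⟩
    rw [mul_apply, hs₂P l _ ⟨y, hy, rfl⟩, hq]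

lemma mem_pow_of_eqOn_brick [CompactSpace X] [T2Space X] (h : IsTower x Ω V σ) (hsym : W = W⁻¹)
    (hcov : ∃ g : ℕ → X ≃ₜ X, (⋃ i, g i • W) = Set.univ)
    (hW : ∀ n, suppIn (Ω \ V n) ⊆ W ^ 20) {S I : Set ℕ} (hSW : suppIn (pieces V S) ⊆ W ^ 16)
    (hIS : I ⊆ S) (hI : I.Infinite) (hSI : (S \ I).Infinite) {g : X ≃ₜ X} (hg : g ∈ suppIn Ω)
    (hgx : g x = x) (hgI : ∀ y ∈ pieces V I, g y = y) : g ∈ W ^ 60 := by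
  have hΩ : IsClopen Ω := h.zero ▸ h.clopen 0
  have hgx' : g⁻¹ x = x := by
    conv_lhs => rw [← hgx]
    simp only [inv_apply_self]
  obtain ⟨n, r, hr, hrs, hrm⟩ := exists_push h hsym hcov (S := Sᶜ) (T := I)
    (disjoint_left.2 fun k hk hk' => hk (hIS hk')) hI
  obtain ⟨n₂, hn₂⟩ := h.basis (⇑(g⁻¹ : X ≃ₜ X) ⁻¹' V n) (g⁻¹.continuous.continuousAt (by
    rw [hgx']
    exact (h.clopen n).isOpen.mem_nhds (h.mem n)))
  obtain ⟨j, hj, hlt⟩ := hSI.exists_gt (max n n₂)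
  rw [max_lt_iff] at hlt
  set K : Set X := Ω \ V n with hK
  have hKc : IsClopen K := hΩ.diff (h.clopen n)
  have hKj : ∀ y ∈ K, y ∉ V j := fun y hy hyj => hy.2 (h.anti hlt.1.le hyj)
  have hσK : ∀ y ∈ K, σ j y ∈ V j \ V (j + 1) := fun y hy => h.map j y hy.1 (hKj y hy)
  have hgK : ∀ y ∈ K, g y ∉ V j := fun y hy hyj => by
    have : g⁻¹ (g y) ∈ V n := hn₂ (h.anti hlt.2.le hyj)
    rw [inv_apply_self] at this
    exact hy.2 this
  obtain ⟨t₁, ht₁, ht₁K, -⟩ := exists_swap hKc (σ j) fun y hy hy' => hKj _ hy' (hσK y hy).1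
  have hq : ∀ y, (g * (σ j)⁻¹) (σ j y) = g y := fun y => by rw [mul_apply, inv_apply_self]
  obtain ⟨t₂, ht₂, ht₂K, -⟩ := exists_swap (P := σ j '' K)
    ⟨(σ j).isClosedMap _ hKc.isClosed, (σ j).isOpenMap _ hKc.isOpen⟩ (g * (σ j)⁻¹) (by
      rintro _ ⟨y, hy, rfl⟩ ⟨z, hz, hzy⟩
      rw [hq] at hzy
      exact hgK y hy (hzy ▸ (hσK z hz).1))
  have ht₁Ω : t₁ ∈ suppIn (Ω \ V (j + 1)) := by
    refine suppIn_mono ?_ ht₁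
    rintro y (hy | ⟨z, hz, rfl⟩)
    · exact ⟨hy.1, fun hyj => hKj y hy (h.anti j.le_succ hyj)⟩
    · exact ⟨h.subset j (hσK z hz).1, (hσK z hz).2⟩
  have ht₂Ω : t₂ ∈ suppIn (Ω \ V (j + 1)) := by
    refine suppIn_mono ?_ ht₂
    rintro y (⟨z, hz, rfl⟩ | ⟨_, ⟨z, hz, rfl⟩, rfl⟩)
    · exact ⟨h.subset j (hσK z hz).1, (hσK z hz).2⟩
    · rw [hq]
      exact ⟨apply_mem_of_suppOn hg hz.1, fun hyj => hgK z hz (h.anti j.le_succ hyj)⟩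
  have hcancel : ∀ y, t₂ (t₁ y) = g y → ((t₂ * t₁)⁻¹ * g) y = y := fun y hy => by
    rw [mul_apply, ← hy, ← mul_apply t₂, inv_apply_self]
  have hsupp : (t₂ * t₁)⁻¹ * g ∈ suppIn ((V n \ {x}) \ pieces V I) := by
    intro y hy
    apply hcancel
    by_cases hyΩ : y ∈ Ω
    swap
    · rw [hg y hyΩ, ht₁Ω y fun hh => hyΩ hh.1, ht₂Ω y fun hh => hyΩ hh.1]
    by_cases hyn : y ∈ V n
    swap
    · rw [ht₁K y ⟨hyΩ, hyn⟩, ht₂K _ ⟨y, ⟨hyΩ, hyn⟩, rfl⟩, hq]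
    by_cases hyx : y = x
    · subst hyx
      rw [hgx, ht₁Ω y fun hh => hh.2 (h.mem _), ht₂Ω y fun hh => hh.2 (h.mem _)]
    have hyI : y ∈ pieces V I := by_contra fun hyI => hy ⟨⟨hyn, hyx⟩, hyI⟩
    have hyσ : y ∉ σ j '' K := by
      rintro ⟨z, hz, rfl⟩
      obtain ⟨k, hk, hyk⟩ := hyI
      exact hj.2 (h.ring_unique hyk (hσK z hz) ▸ hk)
    rw [hgI y hyI, ht₁ y, ht₂ y]
    · rintro (hyK | ⟨_, ⟨z, hz, rfl⟩, hzy⟩)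
      · exact hyσ hyK
      · rw [hq] at hzy
        have : z = y := g.injective (hzy.trans (hgI y hyI).symm)
        exact hz.2 (this ▸ hyn)
    · rintro (hyK | hyK)
      · exact hyK.2 hyn
      · exact hyσ hyK
  have hrS : ∀ y ∈ (V n \ {x}) \ pieces V I, r y ∈ pieces V S := by
    rintro y ⟨⟨hyn, hyx⟩, hyI⟩
    obtain ⟨k, hk⟩ := h.exists_ring (h.subset n hyn) hyx
    by_cases hkS : k ∈ S
    · rw [hrs y]
      · exact ⟨k, hkS, hk⟩
      · rintro ⟨l, hl, hyl⟩
        obtain rfl := h.ring_unique hk hyl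
        rcases hl with hl | hl
        · exact hl hkS
        · exact hyI ⟨k, hl, hk⟩
    · refine pieces_mono V hIS (hrm k hkS ?_ y hk)
      by_contra hkn
      exact h.not_mem_of_ring (not_le.1 hkn) hk hyn
  have h₂ : (t₂ * t₁)⁻¹ * g ∈ W ^ 20 :=
    mem_pow_of_conj hsym (pow_two W ▸ hr) (hSW (conj_mem_suppIn hsupp hrS))
  have := mul_mem_pow (mul_mem_pow (hW _ ht₂Ω) (hW _ ht₁Ω)) h₂
  rwa [mul_inv_cancel_left] at this

lemma mem_pow_of_map_eq [CompactSpace X] [T2Space X] (h : IsTower x Ω V σ) (hsym : W = W⁻¹)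
    (hcov : ∃ g : ℕ → X ≃ₜ X, (⋃ i, g i • W) = Set.univ)
    (hW : ∀ n, suppIn (Ω \ V n) ⊆ W ^ 20) {S : Set ℕ} (hS : S.Infinite)
    (hSW : suppIn (pieces V S) ⊆ W ^ 16) {g : X ≃ₜ X} (hg : g ∈ suppIn Ω) (hgx : g x = x) :
    g ∈ W ^ 96 := by
  obtain ⟨I, hIS, hI, hSI, s, hsW, hsΩ, hsx, hsI⟩ := exists_eqOn_brick h hsym hcov hS hSW hg hgx
  have hcancel : ∀ y, s y = g y → (s⁻¹ * g) y = y := fun y hy => by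
    rw [mul_apply, ← hy, inv_apply_self]
  have h₁ : s⁻¹ * g ∈ W ^ 60 := mem_pow_of_eqOn_brick h hsym hcov hW hSW hIS hI hSI
    (suppOn_mul (suppOn_inv hsΩ) hg) (hcancel x (hsx.trans hgx.symm))
    fun y hy => hcancel y (hsI y hy)
  have := mul_mem_pow hsW h₁
  rwa [mul_inv_cancel_left] at this

lemma pow_subset_pow_add_two_mul (hsym : W = W⁻¹) (hne : W.Nonempty) (m k : ℕ) :
    W ^ m ⊆ W ^ (m + 2 * k) := by
  intro f hf
  obtain ⟨w, hw⟩ := hne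
  have h1 : (1 : X ≃ₜ X) ∈ W ^ 2 := by
    rw [pow_two]
    exact ⟨w, hw, w⁻¹, hsym ▸ Set.inv_mem_inv.2 hw, mul_inv_cancel w⟩
  have h2 : (1 : X ≃ₜ X) ∈ W ^ (2 * k) := by
    rw [pow_mul]
    exact Set.one_mem_pow h1
  simpa using mul_mem_pow hf h2

end StableSteinhaus

/-- Theorem 3.17 (local Steinhaus): if `Ω` is a stable neighborhood of `x`, `W` is
symmetric, countably many left translates of `W` cover `Homeo(X)`, and `G(Ω)` lies in the
closure of `W * W`, then `G(Ω) ⊆ W ^ 96`. -/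
theorem local_steinhaus (X : Type*) [TopologicalSpace X] [CompactSpace X]
    [TopologicalSpace.MetrizableSpace X] [TotallyDisconnectedSpace X] [Nonempty X]
    (x : X) (Ω : Set X) (hΩ : IsStableNbhd x Ω)
    (W : Set (X ≃ₜ X)) (hsym : W = W⁻¹)
    (hcov : ∃ g : ℕ → X ≃ₜ X, (⋃ i, g i • W) = Set.univ)
    (hdense : suppIn Ω ⊆ closure (W * W)) :
    suppIn Ω ⊆ W ^ 96 := by
  obtain ⟨V, σ, h⟩ := StableSteinhaus.exists_tower hΩ
  obtain ⟨S, hS, hSW⟩ := StableSteinhaus.exists_brick_subset_pow h hsym hcov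
  have hW := StableSteinhaus.suppIn_diff_subset_pow h hsym hdense hS hSW
  intro g hg
  by_cases hgx : g x = x
  · exact StableSteinhaus.mem_pow_of_map_eq h hsym hcov hW hS hSW hg hgx
  · have hne : W.Nonempty := by
      by_contra hW
      obtain ⟨f, hf⟩ := hcov
      simp [Set.not_nonempty_iff_eq_empty.1 hW, Set.empty_ne_univ] at hf
    exact StableSteinhaus.pow_subset_pow_add_two_mul hsym hne 44 26
      (StableSteinhaus.mem_pow_of_map_ne h hsym hdense hW hg hgx)
end

section
/- Let X be a second countable Stone space and suppose X is stable. Then X can be written as a finite disjoint union X = T₁ ⊔ ⋯ ⊔ T_N of clopen subsets such that each T_i is a stable neighborhood of one of its points. -/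
open Pointwise Topology

/-- The map sending `E (n, w)` to `E (n + 1, w)` and fixing everything outside the range
of `E`. -/
noncomputable def shiftAlong {X W : Type*} (E : ℕ × W → X) : X → X :=
  Function.extend E (fun p => E (p.1 + 1, p.2)) id

section shiftAlong

variable {X W : Type*} {E : ℕ × W → X}

theorem shiftAlong_apply (hE : Function.Injective E) (n : ℕ) (w : W) :
    shiftAlong E (E (n, w)) = E (n + 1, w) :=
  hE.extend_apply _ _ (n, w)

theorem shiftAlong_of_notMem {y : X} (hy : y ∉ Set.range E) : shiftAlong E y = y :=
  Function.extend_apply' _ _ _ hy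

theorem shiftAlong_injective (hE : Function.Injective E) :
    Function.Injective (shiftAlong E) := by
  intro y z hyz
  by_cases hy : y ∈ Set.range E <;> by_cases hz : z ∈ Set.range E
  · obtain ⟨⟨n, v⟩, rfl⟩ := hy
    obtain ⟨⟨m, w⟩, rfl⟩ := hz
    rw [shiftAlong_apply hE, shiftAlong_apply hE] at hyz
    have := hE hyz
    simp_all
  · obtain ⟨⟨n, v⟩, rfl⟩ := hy
    rw [shiftAlong_apply hE, shiftAlong_of_notMem hz] at hyz
    exact absurd ⟨_, hyz⟩ hz
  · obtain ⟨⟨n, v⟩, rfl⟩ := hz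
    rw [shiftAlong_apply hE, shiftAlong_of_notMem hy] at hyz
    exact absurd ⟨_, hyz.symm⟩ hy
  · rwa [shiftAlong_of_notMem hy, shiftAlong_of_notMem hz] at hyz

theorem shiftAlong_image {A : Set X} (hE : Function.Injective E) (hA : Set.range E ⊆ A) :
    shiftAlong E '' A = A \ Set.range fun w => E (0, w) := by
  ext y
  constructor
  · rintro ⟨z, hz, rfl⟩
    by_cases hzE : z ∈ Set.range E
    · obtain ⟨⟨n, w⟩, rfl⟩ := hzE
      rw [shiftAlong_apply hE]
      refine ⟨hA ⟨_, rfl⟩, ?_⟩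
      rintro ⟨v, hv⟩
      simpa using hE hv
    · rw [shiftAlong_of_notMem hzE]
      exact ⟨hz, fun ⟨v, hv⟩ => hzE ⟨_, hv⟩⟩
  · rintro ⟨hyA, hy⟩
    by_cases hyE : y ∈ Set.range E
    · obtain ⟨⟨n, w⟩, rfl⟩ := hyE
      cases n with
      | zero => exact absurd ⟨w, rfl⟩ hy
      | succ n => exact ⟨E (n, w), hA ⟨_, rfl⟩, shiftAlong_apply hE n w⟩
    · exact ⟨y, hyA, shiftAlong_of_notMem hyE⟩

end shiftAlong

section

variable {X : Type*} [TopologicalSpace X]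

/-- `A` and `B` are homeomorphic by a map fixing their common point `x`. -/
def PointedHomeo (x : X) (A B : Set X) : Prop :=
  ∃ Φ : A ≃ₜ B, ∃ hx : x ∈ A, (Φ ⟨x, hx⟩ : X) = x

theorem PointedHomeo.symm {x : X} {A B : Set X} (h : PointedHomeo x A B) :
    PointedHomeo x B A := by
  obtain ⟨Φ, hx, h⟩ := h
  have hB : x ∈ B := h ▸ (Φ ⟨x, hx⟩).2
  refine ⟨Φ.symm, hB, ?_⟩
  have : (⟨x, hB⟩ : B) = Φ ⟨x, hx⟩ := Subtype.ext h.symm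
  rw [this, Φ.symm_apply_apply]

theorem PointedHomeo.trans {x : X} {A B C : Set X} (h : PointedHomeo x A B)
    (h' : PointedHomeo x B C) : PointedHomeo x A C := by
  obtain ⟨Φ, hA, h⟩ := h
  obtain ⟨Ψ, hB, h'⟩ := h'
  refine ⟨Φ.trans Ψ, hA, ?_⟩
  have : Φ ⟨x, hA⟩ = ⟨x, hB⟩ := Subtype.ext h
  rw [Homeomorph.trans_apply, this, h']

namespace IsStableNbhd

variable {x : X} {U V : Set X}

theorem mem (h : IsStableNbhd x U) : x ∈ U := mem_of_mem_nhds h.2.1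

theorem pointedHomeo (h : IsStableNbhd x U) (hVU : V ⊆ U) (hV : IsClopen V) (hx : x ∈ V) :
    PointedHomeo x U V := by
  obtain ⟨Φ, hΦ⟩ := h.2.2 V hVU hV (hV.isOpen.mem_nhds hx)
  exact ⟨Φ, h.mem, hΦ _⟩

theorem of_pointedHomeo (hU : IsClopen U) (hx : x ∈ U)
    (h : ∀ V ⊆ U, IsClopen V → x ∈ V → PointedHomeo x U V) : IsStableNbhd x U := by
  refine ⟨hU, hU.isOpen.mem_nhds hx, fun V hVU hV hxV => ?_⟩
  obtain ⟨Φ, _, hΦ⟩ := h V hVU hV (mem_of_mem_nhds hxV)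
  exact ⟨Φ, fun _ => hΦ⟩

theorem mono (h : IsStableNbhd x U) (hVU : V ⊆ U) (hV : IsClopen V) (hx : x ∈ V) :
    IsStableNbhd x V :=
  of_pointedHomeo hV hx fun _ hWV hW hxW =>
    (h.pointedHomeo hVU hV hx).symm.trans (h.pointedHomeo (hWV.trans hVU) hW hxW)

end IsStableNbhd

theorem shiftAlong_continuous [T2Space X] {W : Type*} [TopologicalSpace W] [CompactSpace W]
    {E : ℕ × W → X} {x : X}     (hE : IsOpenEmbedding E) (hx : x ∉ Set.range E)
    (hlim : ∀ O ∈ 𝓝 x, ∀ᶠ n in Filter.atTop, ∀ w, E (n, w) ∈ O) :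
    Continuous (shiftAlong E) := by
  have hclosed (k : ℕ) : IsClosed (E '' (Set.Iio k ×ˢ Set.univ)) :=
    (((Set.finite_Iio k).isCompact.prod isCompact_univ).image hE.continuous).isClosed
  have hnot {y : X} (hy : y ∉ Set.range E) (k : ℕ) : (E '' (Set.Iio k ×ˢ Set.univ))ᶜ ∈ 𝓝 y :=
    (hclosed k).isOpen_compl.mem_nhds fun ⟨p, _, hp⟩ => hy ⟨p, hp⟩
  rw [continuous_iff_continuousAt]
  intro y
  by_cases hy : y ∈ Set.range E
  · obtain ⟨p, rfl⟩ := hy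
    rw [← hE.continuousAt_iff]
    have : shiftAlong E ∘ E = fun p => E (p.1 + 1, p.2) :=
      funext fun p => shiftAlong_apply hE.injective p.1 p.2
    rw [this]
    have := hE.continuous
    fun_prop
  by_cases hyx : y = x
  · subst hyx
    intro O hO
    rw [shiftAlong_of_notMem hy] at hO
    obtain ⟨k, hk⟩ := Filter.eventually_atTop.1 (hlim O hO)
    rw [Filter.mem_map]
    filter_upwards [hO, hnot hy k] with z hzO hzk
    by_cases hz : z ∈ Set.range E
    · obtain ⟨⟨n, w⟩, rfl⟩ := hz
      have hn : k ≤ n := by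
        by_contra! h
        exact hzk ⟨(n, w), by simpa using h, rfl⟩
      rw [Set.mem_preimage, shiftAlong_apply hE.injective]
      exact hk _ (by omega) w
    · rwa [Set.mem_preimage, shiftAlong_of_notMem hz]
  · obtain ⟨O, O', hO, hO', hyO, hxO', hdisj⟩ := t2_separation hyx
    obtain ⟨k, hk⟩ := Filter.eventually_atTop.1 (hlim O' (hO'.mem_nhds hxO'))
    have : id =ᶠ[𝓝 y] shiftAlong E := by
      filter_upwards [hO.mem_nhds hyO, hnot hy k] with z hzO hzk
      rw [shiftAlong_of_notMem, id]
      rintro ⟨⟨n, w⟩, rfl⟩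
      rcases lt_or_ge n k with h | h
      · exact hzk ⟨(n, w), by simpa using h, rfl⟩
      · exact Set.disjoint_left.1 hdisj hzO (hk n h w)
    exact continuousAt_id.congr this

section Compact

variable [CompactSpace X] [TopologicalSpace.MetrizableSpace X] [TotallyDisconnectedSpace X]
  {x : X} {U W : Set X}

/-- A stable neighborhood of `x` contains disjoint copies, converging to `x`, of any of its
clopen subsets avoiding `x`. -/
theorem IsStableNbhd.exists_copies (hU : IsStableNbhd x U) {Z : Type*} [TopologicalSpace Z]
    [CompactSpace Z] {g : Z → U} (hg : IsOpenEmbedding g) (hgx : ∀ z, (g z : X) ≠ x) :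
    ∃ e : ℕ → Z → X, (∀ n, IsOpenEmbedding (e n)) ∧ (∀ n z, e n z ∈ U) ∧
      (∀ n z, e n z ≠ x) ∧ (∀ m n z w, e m z = e n w → m = n) ∧
      ∀ O ∈ 𝓝 x, ∀ᶠ n in Filter.atTop, ∀ z, e n z ∈ O := by
  obtain ⟨B, hB⟩ := (𝓝 x).exists_antitone_basis
  have step (n : ℕ) (N : {N : Set X // IsClopen N ∧ x ∈ N ∧ N ⊆ U}) :
      ∃ (N' : {N : Set X // IsClopen N ∧ x ∈ N ∧ N ⊆ U}) (e : Z → X), N'.1 ⊆ N.1 ∧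
        N'.1 ⊆ B n ∧ IsOpenEmbedding e ∧ (∀ z, e z ∈ N.1) ∧ ∀ z, e z ∉ N'.1 := by
    obtain ⟨N, hN, hxN, hNU⟩ := N
    obtain ⟨Φ, hx, hΦ⟩ := hU.pointedHomeo hNU hN hxN
    have he : IsOpenEmbedding fun z => (Φ (g z) : X) :=
      hN.isOpen.isOpenEmbedding_subtypeVal.comp (Φ.isOpenEmbedding.comp hg)
    have hxe : x ∉ Set.range fun z => (Φ (g z) : X) := by
      rintro ⟨z, hz⟩
      have : Φ (g z) = Φ ⟨x, hx⟩ := Subtype.ext (hz.trans hΦ.symm)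
      exact hgx z (congrArg Subtype.val (Φ.injective this))
    have hnhds : N ∩ B n ∩ (Set.range fun z => (Φ (g z) : X))ᶜ ∈ 𝓝 x :=
      Filter.inter_mem (Filter.inter_mem (hN.isOpen.mem_nhds hxN) (hB.1.mem_of_mem trivial))
        ((isCompact_range he.continuous).isClosed.isOpen_compl.mem_nhds hxe)
    obtain ⟨N', ⟨hxN', hN'⟩, hsub⟩ := (nhds_basis_clopen x).mem_iff.1 hnhds
    exact ⟨⟨N', hN', hxN', fun y hy => hNU (hsub hy).1.1⟩, fun z => Φ (g z),
      fun y hy => (hsub hy).1.1, fun y hy => (hsub hy).1.2, he, fun z => (Φ (g z)).2,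
      fun z hz => (hsub hz).2 ⟨z, rfl⟩⟩
  choose F e hFN hFB he heN heF using step
  let N : ℕ → {N : Set X // IsClopen N ∧ x ∈ N ∧ N ⊆ U} :=
    fun n => Nat.rec ⟨U, hU.1, hU.mem, subset_rfl⟩ F n
  have hanti : Antitone fun n => (N n).1 := antitone_nat_of_succ_le fun n => hFN n (N n)
  have hne {m n : ℕ} (hmn : m < n) (z w : Z) : e m (N m) z ≠ e n (N n) w := fun h =>
    heF m (N m) z (hanti (Nat.succ_le_of_lt hmn) (h ▸ heN n (N n) w))
  refine ⟨fun n => e n (N n), fun n => he _ _, fun n z => (N n).2.2.2 (heN _ _ z),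
    fun n z h => ?_, fun m n z w h => ?_, fun O hO => ?_⟩
  · have hx : x ∈ (N (n + 1)).1 := (N (n + 1)).2.2.1
    exact heF n (N n) z (Set.mem_of_eq_of_mem h hx)
  · rcases lt_trichotomy m n with hmn | hmn | hmn
    · exact absurd h (hne hmn z w)
    · exact hmn
    · exact absurd h.symm (hne hmn w z)
  · obtain ⟨k, -, hk⟩ := hB.1.mem_iff.1 hO
    filter_upwards [Filter.eventually_ge_atTop (k + 1)] with n hn z
    exact hk (hFB k (N k) (hanti hn (heN n (N n) z)))

theorem IsStableNbhd.pointedHomeo_union (hU : IsStableNbhd x U) (hW : IsClopen W)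
    (hd : Disjoint U W) {g : W → U} (hg : IsOpenEmbedding g) (hgx : ∀ w, (g w : X) ≠ x) :
    PointedHomeo x (U ∪ W) U := by
  have : CompactSpace W := isCompact_iff_compactSpace.1 hW.isClosed.isCompact
  obtain ⟨e, he, heU, hex, hinj, hlim⟩ := hU.exists_copies hg hgx
  let e' : ℕ → W → X := fun n => Nat.casesOn n Subtype.val e
  let E : ℕ × W → X := fun p => e' p.1 p.2
  have he' (n : ℕ) : IsOpenEmbedding (e' n) := by
    cases n with
    | zero => exact hW.isOpen.isOpenEmbedding_subtypeVal
    | succ n => exact he n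
  have hxW : x ∉ W := Set.disjoint_left.1 hd hU.mem
  have hEinj : Function.Injective E := by
    rintro ⟨m, v⟩ ⟨n, w⟩ h
    have hmn : m = n := by
      cases m with
      | zero =>
        cases n with
        | zero => rfl
        | succ n =>
          have h : (v : X) = e n w := h
          exact absurd (h ▸ heU n w) (Set.disjoint_right.1 hd v.2)
      | succ m =>
        cases n with
        | zero =>
          have h : e m v = w := h
          exact absurd (h ▸ heU m v) (Set.disjoint_right.1 hd w.2)
        | succ n => exact congrArg Nat.succ (hinj m n v w h)
    subst hmn
    exact congrArg _ ((he' m).injective h)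
  have hE : IsOpenEmbedding E := by
    refine .of_continuous_injective_isOpenMap ?_ hEinj ?_
    · exact continuous_prod_of_discrete_left.2 fun n => (he' n).continuous
    · exact isOpenMap_prod_of_discrete_left.2 fun n => (he' n).isOpenMap
  have hxE : x ∉ Set.range E := by
    rintro ⟨⟨n, w⟩, h⟩
    cases n with
    | zero => exact hxW (h ▸ w.2)
    | succ n => exact hex n w h
  have hElim : ∀ O ∈ 𝓝 x, ∀ᶠ n in Filter.atTop, ∀ w, E (n, w) ∈ O := fun O hO => by
    obtain ⟨k, hk⟩ := Filter.eventually_atTop.1 (hlim O hO)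
    filter_upwards [Filter.eventually_ge_atTop (k + 1)] with n hn
    cases n with
    | zero => omega
    | succ n => exact hk n (by omega)
  have hEsub : Set.range E ⊆ U ∪ W := by
    rintro _ ⟨⟨n, w⟩, rfl⟩
    cases n with
    | zero => exact .inr w.2
    | succ n => exact .inl (heU n w)
  have hf := (shiftAlong_continuous hE hxE hElim).isClosedEmbedding (shiftAlong_injective hEinj)
  have himage : shiftAlong E '' (U ∪ W) = U := by
    rw [shiftAlong_image hEinj hEsub]
    have : (Set.range fun w => E (0, w)) = W := Subtype.range_coe
    rw [this, Set.union_sdiff_right, hd.sdiff_eq_left]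
  exact ⟨(hf.isEmbedding.homeomorphImage _).trans (.setCongr himage), .inl hU.mem,
    shiftAlong_of_notMem hxE⟩

theorem IsStableNbhd.union (hU : IsStableNbhd x U) (hW : IsClopen W)
    (hd : Disjoint U W) {g : W → U} (hg : IsOpenEmbedding g) (hgx : ∀ w, (g w : X) ≠ x) :
    IsStableNbhd x (U ∪ W) := by
  refine .of_pointedHomeo (hU.1.union hW) (.inl hU.mem) fun V hV hVc hxV => ?_
  refine (hU.pointedHomeo_union hW hd hg hgx).trans ?_
  have hVU : IsClopen (V ∩ U) := hVc.inter hU.1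
  have hxVU : x ∈ V ∩ U := ⟨hxV, hU.mem⟩
  have hUV := hU.pointedHomeo Set.inter_subset_right hVU hxVU
  refine hUV.trans ?_
  obtain ⟨Φ, hx, hΦ⟩ := hUV
  have hVW : IsClopen (V ∩ W) := hVc.inter hW
  have hg' := Φ.isOpenEmbedding.comp (hg.comp
    (IsOpenEmbedding.inclusion (Set.inter_subset_right : V ∩ W ⊆ W)
      (hVW.isOpen.preimage continuous_subtype_val)))
  have key := (hU.mono Set.inter_subset_right hVU hxVU).pointedHomeo_union hVW
    (hd.mono Set.inter_subset_right Set.inter_subset_right) hg' fun w hw => by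
      have : Φ (g (Set.inclusion Set.inter_subset_right w)) = Φ ⟨x, hx⟩ :=
        Subtype.ext (hw.trans hΦ.symm)
      exact hgx _ (congrArg Subtype.val (Φ.injective this))
  rw [← Set.inter_union_distrib_left, Set.inter_eq_left.2 hV] at key
  exact key.symm

/-- A stable neighborhood `T` of `t` absorbs a clopen set `V` disjoint from it, as soon as `V`
lies in a stable neighborhood of a point of `T`. -/
theorem IsStableNbhd.absorb {t : X} {T V : Set X} (hT : IsStableNbhd t T)
    (hU : IsStableNbhd x U) (hxT : x ∈ T) (hV : IsClopen V) (hVU : V ⊆ U)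
    (hd : Disjoint T V) : IsStableNbhd t (T ∪ V) := by
  obtain ⟨N, hN, hxN, hNT, htN⟩ : ∃ N : Set X, IsClopen N ∧ x ∈ N ∧ N ⊆ U ∩ T ∧
      (t ∈ N → t = x) := by
    by_cases htx : t = x
    · exact ⟨U ∩ T, hU.1.inter hT.1, ⟨hU.mem, hxT⟩, subset_rfl, fun _ => htx⟩
    · have hnhds : U ∩ T ∩ {t}ᶜ ∈ 𝓝 x :=
        Filter.inter_mem ((hU.1.inter hT.1).isOpen.mem_nhds ⟨hU.mem, hxT⟩)
          (isOpen_compl_singleton.mem_nhds (Ne.symm htx))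
      obtain ⟨N, ⟨hxN, hN⟩, hsub⟩ := (nhds_basis_clopen x).mem_iff.1 hnhds
      exact ⟨N, hN, hxN, fun y hy => (hsub hy).1, fun h => absurd rfl (hsub h).2⟩
  obtain ⟨Φ, hx, hΦ⟩ := hU.pointedHomeo (hNT.trans Set.inter_subset_left) hN hxN
  refine hT.union hV hd ((IsOpenEmbedding.inclusion
    (hNT.trans Set.inter_subset_right) (hN.isOpen.preimage continuous_subtype_val)).comp
      (Φ.isOpenEmbedding.comp (IsOpenEmbedding.inclusion hVU
        (hV.isOpen.preimage continuous_subtype_val)))) ?_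
  intro w hw
  replace hw : (Φ (Set.inclusion hVU w) : X) = t := hw
  have htx : t = x := htN (hw ▸ (Φ _).2)
  have : Φ (Set.inclusion hVU w) = Φ ⟨x, hx⟩ := Subtype.ext (hw.trans (htx.trans hΦ.symm))
  have hwx : (w : X) = x := congrArg Subtype.val (Φ.injective this)
  exact Set.disjoint_left.1 hd hxT (hwx ▸ w.2)

/-- `C` is a finite disjoint union of stable neighborhoods of points. -/
def HasStablePartition {X : Type*} [TopologicalSpace X] (C : Set X) : Prop :=
  ∃ (N : ℕ) (T : Fin N → Set X), (∀ i j, i ≠ j → Disjoint (T i) (T j)) ∧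
    (⋃ i, T i) = C ∧ ∀ i, ∃ x ∈ T i, IsStableNbhd x (T i)

theorem HasStablePartition.union {C : Set X} (hC : HasStablePartition C)
    (hU : IsStableNbhd x U) : HasStablePartition (C ∪ U) := by
  obtain ⟨N, T, hdisj, rfl, hT⟩ := hC
  have hTc (i : Fin N) : IsClopen (T i) := (hT i).choose_spec.2.1
  have hV : IsClopen (U \ ⋃ i, T i) := hU.1.diff (isClopen_iUnion_of_finite hTc)
  have hTV (i : Fin N) : Disjoint (T i) (U \ ⋃ i, T i) :=
    Set.disjoint_sdiff_right.mono_left (Set.subset_iUnion T i)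
  rw [← Set.union_sdiff_self]
  generalize hVdef : U \ ⋃ i, T i = V at hV hTV
  have hVU : V ⊆ U := hVdef ▸ Set.sdiff_subset
  by_cases hx : x ∈ ⋃ i, T i
  · obtain ⟨k, hk⟩ := Set.mem_iUnion.1 hx
    refine ⟨N, fun i => if i = k then T i ∪ V else T i, fun i j hij => ?_, ?_, fun i => ?_⟩
    · have := hdisj i j hij
      have := hTV i
      have := (hTV j).symm
      dsimp only
      split_ifs with h h'
      · exact absurd (h.trans h'.symm) hij
      all_goals simp_all
    · ext y
      simp only [Set.mem_iUnion, Set.mem_union]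
      constructor
      · rintro ⟨i, hi⟩
        split_ifs at hi
        · exact hi.imp (fun h => ⟨i, h⟩) id
        · exact .inl ⟨i, hi⟩
      · rintro (⟨i, hi⟩ | hy)
        · refine ⟨i, ?_⟩
          split_ifs
          · exact .inl hi
          · exact hi
        · exact ⟨k, by simp [hy]⟩
    · obtain ⟨t, ht, hst⟩ := hT i
      dsimp only
      split_ifs with h
      · subst h
        exact ⟨t, .inl ht, hst.absorb hU hk hV hVU (hTV i)⟩
      · exact ⟨t, ht, hst⟩
  · have hxV : x ∈ V := hVdef ▸ ⟨hU.mem, hx⟩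
    refine ⟨N + 1, Fin.cons V T, fun i j hij => ?_, ?_, fun i => ?_⟩
    · cases i using Fin.cases <;> cases j using Fin.cases
      · exact absurd rfl hij
      · exact (hTV _).symm
      · exact hTV _
      · exact hdisj _ _ fun h => hij (congrArg _ h)
    · ext y
      simp [or_comm]
    · cases i using Fin.cases with
      | zero => exact ⟨x, hxV, hU.mono hVU hV hxV⟩
      | succ i => exact hT i

end Compact

end

/-- Lemma 3.19: a stable second countable Stone space is a finite disjoint union of clopen
sets, each of which is a stable neighborhood of one of its points. -/
theorem stable_partition (X : Type*) [TopologicalSpace X] [CompactSpace X]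
    [TopologicalSpace.MetrizableSpace X] [TotallyDisconnectedSpace X] [Nonempty X]
    (hstable : ∀ x : X, ∃ U : Set X, IsStableNbhd x U) :
    ∃ (N : ℕ) (T : Fin N → Set X),
      (∀ i j, i ≠ j → Disjoint (T i) (T j)) ∧
      (⋃ i, T i) = Set.univ ∧
      (∀ i, ∃ x ∈ T i, IsStableNbhd x (T i)) := by
  choose U hU using hstable
  obtain ⟨s, hs⟩ := CompactSpace.elim_nhds_subcover U fun x => (hU x).2.1
  have key (s : Finset X) : HasStablePartition (⋃ x ∈ s, U x) := by
    classical
    induction s using Finset.induction_on with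
    | empty => exact ⟨0, Fin.elim0, fun i => i.elim0, by simp, fun i => i.elim0⟩
    | insert a s _ ih =>
      rw [Finset.set_biUnion_insert, Set.union_comm]
      exact ih.union (hU a)
  have h := key s
  rwa [show (⋃ x ∈ s, U x) = Set.univ from hs] at h
end
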